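/- Let g ∈ S₀(ℝ), let α, β > 0 be such that (g, αℤ×βℤ) is a frame sequence with closed linear span 𝒢 = 𝒢(g, αℤ×βℤ) and canonical dual window γ, and let ν ∈ ℕ, ν ≥ 1. Let 𝒦 be the closed linear span of {T_{k/β} M_{ℓ/α} g : k, ℓ ∈ ℤ} and, for s = 0, …, ν−1, let 𝔉_s = {T_{k/β} M_{(ℓν+s)/α} g : k, ℓ ∈ ℤ} and let ℒ_s be its closed linear span. If T_{α/ν} g ∈ 𝒢, then for each s = 0, …, ν−1 the system 𝔉_s is a frame for ℒ_s, and the operator P_s defined by P_s f = (αβ)^{−1} ∑_{k,ℓ∈ℤ} ⟨M_{−s/α} f, T_{k/β} M_{ℓν/α} γ⟩ · M_{s/α} T_{k/β} M_{ℓν/α} g satisfies: P_s f = f for f ∈ ℒ_s, P_s f = 0 for f ∈ ℒ_r with r ≠ s, and P_s f = 0 for f orthogonal to 𝒦. -/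

import Mathlib

open MeasureTheory Complex Filter
open scoped ENNReal InnerProductSpace RealInnerProductSpace ComplexConjugate

noncomputable section

/-- The Hilbert space `L²(ℝ)` of complex-valued square-integrable functions. -/
abbrev L2 : Type := Lp ℂ 2 (volume : Measure ℝ)

lemma memLp_translate (a : ℝ) (f : L2) :
    MemLp (fun x : ℝ => f (x - a)) 2 (volume : Measure ℝ) :=
  (Lp.memLp f).comp_measurePreserving (measurePreserving_sub_right volume a)

lemma memLp_modulate (b : ℝ) (f : L2) :
    MemLp (fun x : ℝ => Complex.exp (2 * Real.pi * Complex.I * (b * x)) * f x) 2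
      (volume : Measure ℝ) := by
  refine MemLp.of_le (Lp.memLp f) ?_ ?_
  · exact (Complex.continuous_exp.comp (by fun_prop)).aestronglyMeasurable.mul
      (Lp.aestronglyMeasurable f)
  · filter_upwards with x
    have : Complex.exp (2 * Real.pi * Complex.I * (b * x))
        = Complex.exp ((2 * Real.pi * (b * x) : ℝ) * Complex.I) := by
      push_cast; ring_nf
    rw [norm_mul, this, Complex.norm_exp_ofReal_mul_I, one_mul]

/-- Translation `T_a` on `L²(ℝ)`: `(T_a f)(x) = f (x - a)`. -/
def Tr (a : ℝ) (f : L2) : L2 := (memLp_translate a f).toLp _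

/-- Modulation `M_b` on `L²(ℝ)`: `(M_b f)(x) = e^{2πibx} f x`. -/
def Mo (b : ℝ) (f : L2) : L2 := (memLp_modulate b f).toLp _

/-- Time-frequency shift `π(a,b) = T_a M_b`. -/
def tf (z : ℝ × ℝ) (f : L2) : L2 := Tr z.1 (Mo z.2 f)

/-- The closed linear span `𝒢(g,Λ)` of the Gabor system `(g,Λ)`. -/
def gaborSpan (g : L2) (Λ : Set (ℝ × ℝ)) : Set L2 :=
  closure (Submodule.span ℂ ((fun z => tf z g) '' Λ) : Set L2)

/-- `𝔍(𝒢)`: the set of time-frequency shifts leaving `𝒢` invariant. -/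
def stab (G : Set L2) : Set (ℝ × ℝ) := {z | ∀ f ∈ G, tf z f ∈ G}

/-- `Λ` is a lattice in `ℝ²` if `Λ = Aℤ²` for an invertible `2×2` matrix `A`. -/
def IsLattice (Λ : Set (ℝ × ℝ)) : Prop :=
  ∃ A : Matrix (Fin 2) (Fin 2) ℝ, IsUnit A.det ∧
    Λ = {p : ℝ × ℝ | ∃ k l : ℤ,
      p = (A 0 0 * k + A 0 1 * l, A 1 0 * k + A 1 1 * l)}

lemma memLp_gaussian : MemLp (fun x : ℝ => (Real.exp (-Real.pi * x ^ 2) : ℂ)) 2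
    (volume : Measure ℝ) := by
  rw [memLp_two_iff_integrable_sq_norm]
  · have h : Integrable (fun x : ℝ => Real.exp (-(2 * Real.pi) * x ^ 2)) volume :=
      integrable_exp_neg_mul_sq (by positivity)
    refine h.congr (Eventually.of_forall fun x => ?_)
    simp only [Complex.norm_real, Real.norm_eq_abs, Real.abs_exp, sq, ← Real.exp_add]
    ring_nf
  · exact (Complex.continuous_ofReal.comp (by fun_prop)).aestronglyMeasurable

/-- The Gaussian `φ(x) = e^{-πx²}` as an element of `L²(ℝ)`. -/
def gaussL2 : L2 := memLp_gaussian.toLp _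

/-- The Feichtinger algebra condition: `f ∈ S₀(ℝ)` iff `(a,b) ↦ ⟨f, π(a,b)φ⟩ ∈ L¹(ℝ²)`. -/
def InS0 (f : L2) : Prop :=
  Integrable (fun z : ℝ × ℝ => ⟪tf z gaussL2, f⟫_ℂ) (volume : Measure (ℝ × ℝ))

/-- `(g,Λ)` is a frame for its closed linear span. -/
def IsFrameSeq (g : L2) (Λ : Set (ℝ × ℝ)) : Prop :=
  ∃ A B : ℝ, 0 < A ∧ 0 < B ∧ ∀ f ∈ gaborSpan g Λ,
    A * ‖f‖ ^ 2 ≤ ∑' lam : Λ, ‖⟪tf (lam : ℝ × ℝ) g, f⟫_ℂ‖ ^ 2 ∧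
    ∑' lam : Λ, ‖⟪tf (lam : ℝ × ℝ) g, f⟫_ℂ‖ ^ 2 ≤ B * ‖f‖ ^ 2

/-- `(g,Λ)` is a frame for all of `L²(ℝ)`. -/
def IsFrameL2 (g : L2) (Λ : Set (ℝ × ℝ)) : Prop :=
  ∃ A B : ℝ, 0 < A ∧ 0 < B ∧ ∀ f : L2,
    A * ‖f‖ ^ 2 ≤ ∑' lam : Λ, ‖⟪tf (lam : ℝ × ℝ) g, f⟫_ℂ‖ ^ 2 ∧
    ∑' lam : Λ, ‖⟪tf (lam : ℝ × ℝ) g, f⟫_ℂ‖ ^ 2 ≤ B * ‖f‖ ^ 2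

/-- Euclidean ball of radius `ε` around `a ∈ ℝ²`. -/
def eball (ε : ℝ) (a : ℝ × ℝ) : Set (ℝ × ℝ) :=
  {x : ℝ × ℝ | Real.sqrt ((x.1 - a.1) ^ 2 + (x.2 - a.2) ^ 2) < ε}

/-- `B_ε(Δ) = ⋃_{a ∈ Δ} B_ε(a)`. -/
def eballSet (ε : ℝ) (Δ : Set (ℝ × ℝ)) : Set (ℝ × ℝ) := ⋃ a ∈ Δ, eball ε a

/-- The separable lattice `αℤ × βℤ`. -/
def sepLattice (α β : ℝ) : Set (ℝ × ℝ) :=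
  {p : ℝ × ℝ | ∃ k l : ℤ, p = (α * k, β * l)}

/-- `γ` is the canonical dual window of the frame sequence `(g, αℤ×βℤ)`:
`γ` belongs to `𝒢(g, αℤ×βℤ)` and `Sγ = g` for the frame operator `S`,
the defining series converging unconditionally in `L²`. -/
def IsDualWindow (g γ : L2) (α β : ℝ) : Prop :=
  γ ∈ gaborSpan g (sepLattice α β) ∧
  HasSum (fun lam : sepLattice α β =>
    ⟪tf (lam : ℝ × ℝ) g, γ⟫_ℂ • tf (lam : ℝ × ℝ) g) g

/-- The closed linear span `𝒦` of the adjoint system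
`{T_{k/β} M_{ℓ/α} g : k, ℓ ∈ ℤ}`, as a (closed) subspace. -/
def Ksub (g : L2) (α β : ℝ) : Submodule ℂ L2 :=
  (Submodule.span ℂ
    {f : L2 | ∃ k l : ℤ, f = tf ((k : ℝ) / β, (l : ℝ) / α) g}).topologicalClosure

/-- The closed linear span `ℒ_s` of `{T_{k/β} M_{(ℓν+s)/α} g : k, ℓ ∈ ℤ}`. -/
def Lsub (g : L2) (α β : ℝ) (ν s : ℕ) : Submodule ℂ L2 :=
  (Submodule.span ℂ
    {f : L2 | ∃ k l : ℤ,
      f = tf ((k : ℝ) / β, ((l : ℝ) * (ν : ℝ) + (s : ℝ)) / α) g}).topologicalClosure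

lemma HasSum.of_forall_eq {ι E : Type*} [AddCommMonoid E] [TopologicalSpace E] {f g : ι → E}
    {a : E} (h : HasSum f a) (hfg : ∀ i, f i = g i) : HasSum g a := by
  rwa [← funext hfg]

/-- The unimodular character `t ↦ e^{2πit}`. -/
def phase (t : ℝ) : ℂ := Complex.exp (2 * Real.pi * Complex.I * t)

lemma phase_add (s t : ℝ) : phase (s + t) = phase s * phase t := by
  simp only [phase, ← Complex.exp_add]
  push_cast
  ring_nf

lemma phase_int (n : ℤ) : phase n = 1 := by
  rw [phase, Complex.exp_eq_one_iff]
  exact ⟨n, by push_cast; ring⟩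

lemma phase_zero : phase 0 = 1 := by simp [phase]

lemma norm_phase (t : ℝ) : ‖phase t‖ = 1 := by
  have : phase t = Complex.exp ((2 * Real.pi * t : ℝ) * Complex.I) := by
    simp only [phase]; push_cast; ring_nf
  rw [this, Complex.norm_exp_ofReal_mul_I]

lemma conj_phase (t : ℝ) : conj (phase t) = phase (-t) := by
  simp only [phase, ← Complex.exp_conj]
  simp [Complex.conj_ofNat]

lemma conj_phase_mul_phase (t : ℝ) : conj (phase t) * phase t = 1 := by
  rw [conj_phase, ← phase_add, neg_add_cancel, phase_zero]

lemma continuous_phase : Continuous phase := by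
  unfold phase
  fun_prop

lemma Tr_coe (a : ℝ) (f : L2) : Tr a f =ᵐ[volume] fun x => f (x - a) :=
  (memLp_translate a f).coeFn_toLp

lemma Mo_coe (b : ℝ) (f : L2) : Mo b f =ᵐ[volume] fun x => phase (b * x) * f x := by
  filter_upwards [(memLp_modulate b f).coeFn_toLp] with x hx
  rw [Mo, hx, phase]
  push_cast
  rfl

lemma ae_comp_sub {P : ℝ → Prop} (a : ℝ) (h : ∀ᵐ x : ℝ, P x) : ∀ᵐ x : ℝ, P (x - a) :=
  (measurePreserving_sub_right volume a).quasiMeasurePreserving.ae h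

lemma tf_coe (z : ℝ × ℝ) (f : L2) :
    tf z f =ᵐ[volume] fun x => phase (z.2 * (x - z.1)) * f (x - z.1) := by
  filter_upwards [Tr_coe z.1 (Mo z.2 f), ae_comp_sub z.1 (Mo_coe z.2 f)] with x h1 h2
  rw [tf, h1, h2]

lemma tf_add_right (z : ℝ × ℝ) (f h : L2) : tf z (f + h) = tf z f + tf z h := by
  apply Lp.ext
  filter_upwards [tf_coe z (f + h), tf_coe z f, tf_coe z h, Lp.coeFn_add (tf z f) (tf z h),
    ae_comp_sub z.1 (Lp.coeFn_add f h)] with x h1 h2 h3 h4 h5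
  rw [h1, h4, Pi.add_apply, h2, h3, h5, Pi.add_apply, mul_add]

lemma tf_smul (z : ℝ × ℝ) (c : ℂ) (f : L2) : tf z (c • f) = c • tf z f := by
  apply Lp.ext
  filter_upwards [tf_coe z (c • f), tf_coe z f, Lp.coeFn_smul c (tf z f),
    ae_comp_sub z.1 (Lp.coeFn_smul c f)] with x h1 h2 h3 h4
  rw [h1, h3, Pi.smul_apply, h2, h4, Pi.smul_apply, smul_eq_mul, smul_eq_mul]
  ring

lemma tf_tf (z w : ℝ × ℝ) (f : L2) : tf z (tf w f) = phase (z.2 * w.1) • tf (z + w) f := by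
  apply Lp.ext
  filter_upwards [tf_coe z (tf w f), ae_comp_sub z.1 (tf_coe w f), tf_coe (z + w) f,
    Lp.coeFn_smul (phase (z.2 * w.1)) (tf (z + w) f)] with x h1 h2 h3 h4
  rw [h1, h2, h4, Pi.smul_apply, h3, smul_eq_mul, ← mul_assoc, ← mul_assoc, ← phase_add,
    ← phase_add, Prod.fst_add, Prod.snd_add, sub_sub]
  congr 2
  ring

lemma tf_zero (f : L2) : tf 0 f = f := by
  apply Lp.ext
  filter_upwards [tf_coe 0 f] with x h1
  simp [h1, phase_zero]

lemma inner_tf_tf (z : ℝ × ℝ) (u f : L2) : ⟪tf z u, tf z f⟫_ℂ = ⟪u, f⟫_ℂ := by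
  rw [L2.inner_def, L2.inner_def]
  rw [← integral_sub_right_eq_self (fun x => ⟪u x, f x⟫_ℂ) z.1]
  refine integral_congr_ae ?_
  filter_upwards [tf_coe z u, tf_coe z f] with x h1 h2
  rw [h1, h2]
  simp only [RCLike.inner_apply, map_mul]
  linear_combination (f (x - z.1) * conj (u (x - z.1))) *
    conj_phase_mul_phase (z.2 * (x - z.1))

/-- The time-frequency shift `π(z)` as a linear isometry. -/
def tfIso (z : ℝ × ℝ) : L2 →ₗᵢ[ℂ] L2 :=
  LinearMap.isometryOfInner
    { toFun := tf z, map_add' := tf_add_right z, map_smul' := tf_smul z } (inner_tf_tf z)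

lemma tfIso_apply (z : ℝ × ℝ) (f : L2) : tfIso z f = tf z f := rfl

lemma norm_tf (z : ℝ × ℝ) (f : L2) : ‖tf z f‖ = ‖f‖ := (tfIso z).norm_map f

lemma tf_tf_neg (z : ℝ × ℝ) (f : L2) : tf z (tf (-z) f) = phase (-(z.1 * z.2)) • f := by
  rw [tf_tf, add_neg_cancel, tf_zero]
  simp [mul_comm]

/-- Moving a time-frequency shift to the other side of the inner product. -/
lemma inner_tf_left (z : ℝ × ℝ) (u f : L2) :
    ⟪tf z u, f⟫_ℂ = phase (z.1 * z.2) * ⟪u, tf (-z) f⟫_ℂ := by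
  rw [← inner_tf_tf z u, tf_tf_neg, inner_smul_right, ← mul_assoc, ← phase_add]
  simp [phase_zero]

/-- Two time-frequency shifts commute up to the symplectic phase. -/
lemma tf_comm (z w : ℝ × ℝ) (f : L2) :
    tf z (tf w f) = phase (z.2 * w.1 - w.2 * z.1) • tf w (tf z f) := by
  rw [tf_tf, tf_tf, smul_smul, ← phase_add, add_comm w z]
  congr 2
  ring

lemma Tr_eq_tf (a : ℝ) (f : L2) : Tr a f = tf (a, 0) f := by
  apply Lp.ext
  filter_upwards [Tr_coe a f, tf_coe (a, 0) f] with x h1 h2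
  simp [h1, h2, phase_zero]

lemma Mo_eq_tf (b : ℝ) (f : L2) : Mo b f = tf (0, b) f := by
  apply Lp.ext
  filter_upwards [Mo_coe b f, tf_coe (0, b) f] with x h1 h2
  simp [h1, h2]

/-- The rank-one operator attached to a pair of windows is insensitive to phases. -/
lemma inner_phase_smul_smul (t : ℝ) (u v f : L2) :
    ⟪phase t • u, f⟫_ℂ • (phase t • v) = ⟪u, f⟫_ℂ • v := by
  rw [inner_smul_left, smul_smul]
  congr 1
  linear_combination ⟪u, f⟫_ℂ * conj_phase_mul_phase t

open scoped Real in
lemma fourierCoeff_liftIoc_eq_integral_phase {b : ℝ} (hb : 0 < b) [Fact (0 < b⁻¹)] (c : ℝ)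
    {F : ℝ → ℂ} (sF : ∀ x, x ∉ Set.Ioc c (c + b⁻¹) → F x = 0) (l : ℤ) :
    fourierCoeff (AddCircle.liftIoc b⁻¹ c F) l = b * ∫ x, phase (-(b * l * x)) * F x := by
  have hlt : c < c + b⁻¹ := by have := inv_pos.mpr hb; linarith
  rw [fourierCoeff_liftIoc_eq, fourierCoeffOn_eq_integral, intervalIntegral.integral_of_le hlt.le,
    setIntegral_eq_integral_of_forall_compl_eq_zero]
  · have e : (1 / (c + b⁻¹ - c) : ℝ) = b := by field_simp; ring
    rw [e, Complex.real_smul]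
    congr 1
    refine integral_congr_ae (ae_of_all _ fun x => ?_)
    simp only [smul_eq_mul]
    rw [fourier_coe_apply, phase]
    congr 2
    have : (c + b⁻¹ - c : ℝ) = b⁻¹ := by ring
    rw [this]
    have hb' : (b : ℂ) ≠ 0 := by exact_mod_cast hb.ne'
    push_cast
    field_simp
  · intro x hx
    rw [sF x hx, smul_zero]

/-- Parseval's identity for functions supported in an interval of length `1 / b`. -/
lemma hasSum_conj_integral_mul_integral {b : ℝ} (hb : 0 < b) (c : ℝ) {F H : ℝ → ℂ}
    (hF : MemLp F 2 volume) (hH : MemLp H 2 volume)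
    (sF : ∀ x, x ∉ Set.Ioc c (c + b⁻¹) → F x = 0)
    (sH : ∀ x, x ∉ Set.Ioc c (c + b⁻¹) → H x = 0) :
    HasSum (fun l : ℤ => conj (∫ x, phase (-(b * l * x)) * H x) *
      ∫ x, phase (-(b * l * x)) * F x) (((b⁻¹ : ℝ) : ℂ) * ∫ x, conj (H x) * F x) := by
  have : Fact (0 < b⁻¹) := ⟨inv_pos.mpr hb⟩
  have hb' : (b : ℂ) ≠ 0 := by exact_mod_cast hb.ne'
  have hlt : c < c + b⁻¹ := by have := inv_pos.mpr hb; linarith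
  have mF := (hF.restrict (Set.Ioc c (c + b⁻¹))).memLp_liftIoc.haarAddCircle
  have mH := (hH.restrict (Set.Ioc c (c + b⁻¹))).memLp_liftIoc.haarAddCircle
  have key := (fourierBasis (T := b⁻¹)).hasSum_inner_mul_inner (mH.toLp _) (mF.toLp _)
  have cF : ∀ l : ℤ, ⟪fourierBasis (T := b⁻¹) l, mF.toLp _⟫_ℂ
      = b * ∫ x, phase (-(b * l * x)) * F x := fun l => by
    rw [← HilbertBasis.repr_apply_apply, fourierBasis_repr,
      fourierCoeff_congr_ae mF.coeFn_toLp, fourierCoeff_liftIoc_eq_integral_phase hb c sF]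
  have cH : ∀ l : ℤ, ⟪mH.toLp _, fourierBasis (T := b⁻¹) l⟫_ℂ
      = b * conj (∫ x, phase (-(b * l * x)) * H x) := fun l => by
    rw [← inner_conj_symm, ← HilbertBasis.repr_apply_apply, fourierBasis_repr,
      fourierCoeff_congr_ae mH.coeFn_toLp, fourierCoeff_liftIoc_eq_integral_phase hb c sH,
      map_mul, Complex.conj_ofReal]
  have cHF : ⟪mH.toLp _, mF.toLp _⟫_ℂ = b * ∫ x, conj (H x) * F x := by
    have e2 : ∀ᵐ a ∂(@AddCircle.haarAddCircle b⁻¹ _), ⟪mH.toLp _ a, mF.toLp _ a⟫_ℂ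
        = AddCircle.liftIoc b⁻¹ c (fun x => conj (H x) * F x) a := by
      filter_upwards [mH.coeFn_toLp, mF.coeFn_toLp] with x h1 h2
      rw [h1, h2]
      simp only [RCLike.inner_apply, AddCircle.liftIoc, Function.comp_apply, Set.domRestrict_apply]
      ring
    rw [L2.inner_def, integral_congr_ae e2, AddCircle.integral_haarAddCircle,
      AddCircle.integral_liftIoc_eq_intervalIntegral, intervalIntegral.integral_of_le hlt.le,
      setIntegral_eq_integral_of_forall_compl_eq_zero, inv_inv, Complex.real_smul]
    intro x hx
    rw [sF x hx, mul_zero]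
  simp only [cF, cH, cHF] at key
  have key2 := key.mul_left (((b : ℂ) ^ 2)⁻¹)
  have e : ((b : ℂ) ^ 2)⁻¹ * (b * ∫ x, conj (H x) * F x)
      = ((b⁻¹ : ℝ) : ℂ) * ∫ x, conj (H x) * F x := by
    push_cast
    field_simp
  rw [e] at key2
  refine key2.of_forall_eq fun l => ?_
  field_simp

lemma inner_tf_eq_integral {u f : L2} {u' f' : ℝ → ℂ} (hu : u =ᵐ[volume] u')
    (hf : f =ᵐ[volume] f') (z : ℝ × ℝ) :
    ⟪tf z u, f⟫_ℂ = phase (z.1 * z.2) *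
      ∫ x, phase (-(z.2 * x)) * (conj (u' (x - z.1)) * f' x) := by
  rw [L2.inner_def, ← integral_const_mul]
  refine integral_congr_ae ?_
  filter_upwards [tf_coe z u, hf, ae_comp_sub z.1 hu] with x h1 h2 h3
  rw [h1, h2, h3, RCLike.inner_apply, map_mul, conj_phase,
    show -(z.2 * (x - z.1)) = z.1 * z.2 + -(z.2 * x) by ring, phase_add]
  ring

/-- The normalized box window: the indicator function of `(0, ε]` in `L²(ℝ)`. -/
def box (ε : ℝ) : L2 :=
  indicatorConstLp 2 (measurableSet_Ioc (a := (0 : ℝ)) (b := ε)) measure_Ioc_lt_top.ne 1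

lemma box_coe (ε : ℝ) : box ε =ᵐ[volume] (Set.Ioc (0 : ℝ) ε).indicator fun _ => (1 : ℂ) :=
  indicatorConstLp_coeFn

lemma hasSum_sq_inner_box_modulations {b ε : ℝ} (hb : 0 < b) (hε : ε ≤ b⁻¹) (a : ℝ) (f : L2) :
    HasSum (fun l : ℤ => ‖⟪tf (a, b * l) (box ε), f⟫_ℂ‖ ^ 2)
      (b⁻¹ * ∫ x in Set.Ioc a (a + ε), ‖f x‖ ^ 2) := by
  set F : ℝ → ℂ := (Set.Ioc a (a + ε)).indicator f with hF
  have mF : MemLp F 2 volume := (Lp.memLp f).indicator measurableSet_Ioc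
  have sF : ∀ x, x ∉ Set.Ioc a (a + b⁻¹) → F x = 0 := fun x hx => by
    rw [hF, Set.indicator_of_notMem]
    exact fun h => hx ⟨h.1, h.2.trans (by linarith)⟩
  have key := hasSum_conj_integral_mul_integral hb a mF mF sF sF
  have e1 : ∀ l : ℤ, ⟪tf (a, b * l) (box ε), f⟫_ℂ
      = phase (a * (b * l)) * ∫ x, phase (-(b * l * x)) * F x := fun l => by
    rw [inner_tf_eq_integral (box_coe ε) (ae_eq_refl _)]
    congr 2
    funext x
    congr 1
    rw [hF]
    by_cases hx : x ∈ Set.Ioc a (a + ε)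
    · rw [Set.indicator_of_mem hx, Set.indicator_of_mem]
      · simp
      · exact ⟨by linarith [hx.1], by linarith [hx.2]⟩
    · rw [Set.indicator_of_notMem hx, Set.indicator_of_notMem]
      · simp
      · exact fun h => hx ⟨by linarith [h.1], by linarith [h.2]⟩
  have e2 : ∫ x, conj (F x) * F x = ((∫ x in Set.Ioc a (a + ε), ‖f x‖ ^ 2 : ℝ) : ℂ) := by
    rw [← integral_indicator measurableSet_Ioc, ← integral_complex_ofReal]
    congr 1
    funext x
    rw [hF]
    by_cases hx : x ∈ Set.Ioc a (a + ε)
    · simp only [Set.indicator_of_mem hx]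
      rw [Complex.conj_mul']
      push_cast
      rfl
    · simp only [Set.indicator_of_notMem hx]
      simp
  rw [e2, ← Complex.ofReal_mul] at key
  rw [← Complex.hasSum_ofReal]
  refine key.of_forall_eq fun l => ?_
  rw [e1, norm_mul, norm_phase, one_mul, Complex.conj_mul']
  push_cast
  rfl

lemma integrable_norm_sq_L2 (f : L2) : Integrable (fun x => ‖f x‖ ^ 2) volume :=
  (Lp.memLp f).integrable_norm_pow (by norm_num)

lemma integral_norm_sq_L2 (f : L2) : ∫ x, ‖f x‖ ^ 2 = ‖f‖ ^ 2 := by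
  have h := inner_self_eq_norm_sq_to_K (𝕜 := ℂ) f
  rw [L2.inner_def] at h
  have e : ∀ x, ⟪f x, f x⟫_ℂ = ((‖f x‖ ^ 2 : ℝ) : ℂ) := fun x => by
    rw [inner_self_eq_norm_sq_to_K]
    push_cast
    rfl
  simp only [e] at h
  rw [integral_complex_ofReal] at h
  exact Complex.ofReal_injective (h.trans (by push_cast; rfl))

lemma pairwise_disjoint_Ioc_mul {a ε : ℝ} (hε : ε ≤ a) :
    Pairwise (Function.onFun Disjoint fun k : ℤ => Set.Ioc (a * k) (a * k + ε)) := by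
  intro i j hij
  wlog h : i < j generalizing i j
  · exact (this hij.symm (lt_of_le_of_ne (not_lt.mp h) hij.symm)).symm
  refine Set.disjoint_left.mpr fun x hx hy => ?_
  have h1 : (i : ℝ) + 1 ≤ j := by exact_mod_cast h
  by_cases h0 : 0 < ε
  · nlinarith [hx.2, hy.1]
  · linarith [hx.1, hx.2]

lemma hasSum_sq_inner_box {a b ε : ℝ} (hb : 0 < b) (hε : ε ≤ b⁻¹) (hεa : ε ≤ a) (f : L2) :
    HasSum (fun kl : ℤ × ℤ => ‖⟪tf (a * kl.1, b * kl.2) (box ε), f⟫_ℂ‖ ^ 2)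
      (b⁻¹ * ∫ x in ⋃ k : ℤ, Set.Ioc (a * k) (a * k + ε), ‖f x‖ ^ 2) := by
  have h1 := fun k : ℤ => hasSum_sq_inner_box_modulations hb hε (a * k) f
  have h2 := (hasSum_integral_iUnion (fun k : ℤ => measurableSet_Ioc)
    (pairwise_disjoint_Ioc_mul hεa) (integrable_norm_sq_L2 f).integrableOn).mul_left b⁻¹
  have hs : Summable (fun kl : ℤ × ℤ => ‖⟪tf (a * kl.1, b * kl.2) (box ε), f⟫_ℂ‖ ^ 2) := by
    rw [summable_prod_of_nonneg (fun _ => by positivity)]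
    refine ⟨fun k => (h1 k).summable, ?_⟩
    simp only [fun k : ℤ => (h1 k).tsum_eq]
    exact h2.summable
  rw [hs.hasSum_iff, hs.tsum_prod]
  simp only [fun k : ℤ => (h1 k).tsum_eq]
  exact h2.tsum_eq

/-- The box windows at lattice step equal to the box length form a tight Gabor frame. -/
lemma hasSum_sq_inner_box_tight {b ε : ℝ} (hb : 0 < b) (h0 : 0 < ε) (hε : ε ≤ b⁻¹) (f : L2) :
    HasSum (fun kl : ℤ × ℤ => ‖⟪tf (ε * kl.1, b * kl.2) (box ε), f⟫_ℂ‖ ^ 2)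
      (b⁻¹ * ‖f‖ ^ 2) := by
  have h := hasSum_sq_inner_box hb hε le_rfl f
  have hU : ⋃ k : ℤ, Set.Ioc (ε * k) (ε * k + ε) = Set.univ := by
    have := iUnion_Ioc_zsmul h0
    simpa [zsmul_eq_mul, add_mul, mul_comm ε] using this
  rwa [hU, setIntegral_univ, integral_norm_sq_L2] at h

lemma eq_of_inner_box_eq {b ε : ℝ} (hb : 0 < b) (h0 : 0 < ε) (hε : ε ≤ b⁻¹) {f h : L2}
    (H : ∀ z, ⟪tf z (box ε), f⟫_ℂ = ⟪tf z (box ε), h⟫_ℂ) : f = h := by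
  have key := hasSum_sq_inner_box_tight hb h0 hε (f - h)
  simp only [inner_sub_right, H, sub_self, norm_zero] at key
  rw [zero_pow two_ne_zero] at key
  have := key.unique hasSum_zero
  have hb' := inv_pos.mpr hb
  rcases mul_eq_zero.mp this with h1 | h1
  · exact absurd h1 hb'.ne'
  · exact sub_eq_zero.mp (norm_eq_zero.mp (pow_eq_zero_iff (two_ne_zero) |>.mp h1))

section Bessel

variable {ι κ H : Type*} [NormedAddCommGroup H] [InnerProductSpace ℂ H]

/-- `e` is a Bessel family with bound `C`. -/
structure IsBessel (e : ι → H) (C : ℝ) : Prop where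
  nonneg : 0 ≤ C
  sum_le : ∀ f : H, ∀ F : Finset ι, ∑ i ∈ F, ‖⟪e i, f⟫_ℂ‖ ^ 2 ≤ C * ‖f‖ ^ 2

lemma IsBessel.summable {e : ι → H} {C : ℝ} (h : IsBessel e C) (f : H) :
    Summable fun i => ‖⟪e i, f⟫_ℂ‖ ^ 2 :=
  summable_of_sum_le (fun _ => by positivity) (h.sum_le f)

lemma IsBessel.tsum_le {e : ι → H} {C : ℝ} (h : IsBessel e C) (f : H) :
    ∑' i, ‖⟪e i, f⟫_ℂ‖ ^ 2 ≤ C * ‖f‖ ^ 2 :=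
  (h.summable f).tsum_le_of_sum_le (h.sum_le f)

lemma IsBessel.comp_injective {e : ι → H} {C : ℝ} (h : IsBessel e C) {φ : κ → ι}
    (hφ : Function.Injective φ) : IsBessel (fun k => e (φ k)) C :=
  ⟨h.nonneg, fun f F => by
    have := h.sum_le f (F.map ⟨φ, hφ⟩)
    rwa [Finset.sum_map] at this⟩

lemma IsBessel.of_hasSum_le {e : ι → H} {C : ℝ} (hC : 0 ≤ C) {s : H → ℝ}
    (h : ∀ f, HasSum (fun i => ‖⟪e i, f⟫_ℂ‖ ^ 2) (s f)) (hs : ∀ f, s f ≤ C * ‖f‖ ^ 2) :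
    IsBessel e C :=
  ⟨hC, fun f F => (sum_le_hasSum F (fun _ _ => by positivity) (h f)).trans (hs f)⟩

lemma IsBessel.norm_sum_smul_sq_le {e : ι → H} {C : ℝ} (h : IsBessel e C) (F : Finset ι)
    (c : ι → ℂ) : ‖∑ i ∈ F, c i • e i‖ ^ 2 ≤ C * ∑ i ∈ F, ‖c i‖ ^ 2 := by
  set x := ∑ i ∈ F, c i • e i with hx
  have h1 : ‖x‖ ^ 2 ≤ ∑ i ∈ F, ‖c i‖ * ‖⟪e i, x⟫_ℂ‖ := by
    have : ((‖x‖ ^ 2 : ℝ) : ℂ) = ∑ i ∈ F, conj (c i) * ⟪e i, x⟫_ℂ := by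
      have h2 := inner_self_eq_norm_sq_to_K (𝕜 := ℂ) x
      rw [show ((‖x‖ ^ 2 : ℝ) : ℂ) = ⟪x, x⟫_ℂ by rw [h2]; push_cast; rfl]
      conv_lhs => rw [hx, sum_inner]
      simp only [inner_smul_left, ← hx]
    calc ‖x‖ ^ 2 = ‖((‖x‖ ^ 2 : ℝ) : ℂ)‖ := by
          rw [Complex.norm_real, Real.norm_of_nonneg (by positivity)]
      _ ≤ _ := by
          rw [this]
          refine (norm_sum_le _ _).trans (le_of_eq ?_)
          simp
  have h2 : (‖x‖ ^ 2) ^ 2 ≤ (∑ i ∈ F, ‖c i‖ ^ 2) * (C * ‖x‖ ^ 2) :=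
    calc (‖x‖ ^ 2) ^ 2 ≤ (∑ i ∈ F, ‖c i‖ * ‖⟪e i, x⟫_ℂ‖) ^ 2 := by gcongr
      _ ≤ (∑ i ∈ F, ‖c i‖ ^ 2) * ∑ i ∈ F, ‖⟪e i, x⟫_ℂ‖ ^ 2 :=
          Finset.sum_mul_sq_le_sq_mul_sq _ _ _
      _ ≤ _ := mul_le_mul_of_nonneg_left (h.sum_le x F)
          (Finset.sum_nonneg fun _ _ => by positivity)
  have hs : 0 ≤ ∑ i ∈ F, ‖c i‖ ^ 2 := Finset.sum_nonneg fun _ _ => by positivity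
  have hC := h.nonneg
  rcases eq_or_lt_of_le (norm_nonneg x) with h0 | h0
  · rw [← h0, zero_pow two_ne_zero]
    positivity
  · have : 0 < ‖x‖ ^ 2 := by positivity
    refine le_of_mul_le_mul_right ?_ this
    nlinarith

lemma IsBessel.of_norm_sum_smul_sq_le {e : ι → H} {C : ℝ} (hC : 0 ≤ C)
    (h : ∀ (F : Finset ι) (c : ι → ℂ),
      ‖∑ i ∈ F, c i • e i‖ ^ 2 ≤ C * ∑ i ∈ F, ‖c i‖ ^ 2) : IsBessel e C := by
  refine ⟨hC, fun f F => ?_⟩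
  set σ := ∑ i ∈ F, ‖⟪e i, f⟫_ℂ‖ ^ 2 with hσ
  have hσ0 : 0 ≤ σ := Finset.sum_nonneg fun _ _ => by positivity
  have h1 : ((σ : ℝ) : ℂ) = ⟪∑ i ∈ F, ⟪e i, f⟫_ℂ • e i, f⟫_ℂ := by
    rw [sum_inner, hσ]
    push_cast
    refine Finset.sum_congr rfl fun i _ => ?_
    rw [inner_smul_left, Complex.conj_mul']
  have h2 : σ ≤ ‖∑ i ∈ F, ⟪e i, f⟫_ℂ • e i‖ * ‖f‖ := by
    calc σ = ‖((σ : ℝ) : ℂ)‖ := by rw [Complex.norm_real, Real.norm_of_nonneg hσ0]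
      _ ≤ _ := by rw [h1]; exact norm_inner_le_norm _ _
  have h3 : σ ^ 2 ≤ C * σ * ‖f‖ ^ 2 :=
    calc σ ^ 2 ≤ (‖∑ i ∈ F, ⟪e i, f⟫_ℂ • e i‖ * ‖f‖) ^ 2 := by gcongr
      _ = ‖∑ i ∈ F, ⟪e i, f⟫_ℂ • e i‖ ^ 2 * ‖f‖ ^ 2 := mul_pow _ _ _
      _ ≤ _ := mul_le_mul_of_nonneg_right (h F _) (by positivity)
  rcases eq_or_lt_of_le hσ0 with h0 | h0
  · rw [← h0]
    positivity
  · refine le_of_mul_le_mul_right ?_ h0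
    nlinarith

lemma IsBessel.summable_smul [CompleteSpace H] {e : ι → H} {C : ℝ} (h : IsBessel e C)
    {c : ι → ℂ} (hc : Summable fun i => ‖c i‖ ^ 2) : Summable fun i => c i • e i := by
  rw [summable_iff_vanishing_norm]
  intro ε hε
  have hC := h.nonneg
  obtain ⟨s, hs⟩ := summable_iff_vanishing_norm.mp hc (ε ^ 2 / (C + 1)) (by positivity)
  refine ⟨s, fun t ht => lt_of_pow_lt_pow_left₀ 2 hε.le ?_⟩
  have h1 := hs t ht
  have h0 : 0 ≤ ∑ i ∈ t, ‖c i‖ ^ 2 := Finset.sum_nonneg fun _ _ => by positivity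
  rw [Real.norm_of_nonneg h0, lt_div_iff₀ (by positivity)] at h1
  refine (h.norm_sum_smul_sq_le t c).trans_lt ?_
  nlinarith

/-- The mixed frame operator of two Bessel families. -/
lemma IsBessel.exists_mixed_frame_operator [CompleteSpace H] {e d : ι → H} {C D : ℝ}
    (he : IsBessel e C) (hd : IsBessel d D) :
    ∃ P : H →L[ℂ] H, ∀ f, HasSum (fun i => ⟪e i, f⟫_ℂ • d i) (P f) := by
  have hs : ∀ f, HasSum (fun i => ⟪e i, f⟫_ℂ • d i) (∑' i, ⟪e i, f⟫_ℂ • d i) := fun f =>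
    (hd.summable_smul (he.summable f)).hasSum
  let L : H →ₗ[ℂ] H :=
    { toFun := fun f => ∑' i, ⟪e i, f⟫_ℂ • d i
      map_add' := fun f f' => by
        refine (((hs f).add (hs f')).of_forall_eq fun i => ?_).tsum_eq
        rw [inner_add_right, add_smul]
      map_smul' := fun c f => by
        refine (((hs f).const_smul c).of_forall_eq fun i => ?_).tsum_eq
        rw [inner_smul_right, mul_smul] }
  refine ⟨L.mkContinuous √(D * C) fun f => ?_, hs⟩
  have hC := he.nonneg
  have hD := hd.nonneg
  refine le_of_tendsto (hs f).norm (Eventually.of_forall fun F => ?_)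
  rw [← Real.sqrt_sq (norm_nonneg f), ← Real.sqrt_mul (by positivity)]
  refine Real.le_sqrt_of_sq_le ((hd.norm_sum_smul_sq_le F _).trans ?_)
  rw [mul_assoc]
  exact mul_le_mul_of_nonneg_left (he.sum_le f F) hD

end Bessel

lemma inner_tf_right (z : ℝ × ℝ) (u f : L2) :
    ⟪u, tf z f⟫_ℂ = phase (-(z.1 * z.2)) * ⟪tf (-z) u, f⟫_ℂ := by
  rw [inner_tf_left, neg_neg, ← mul_assoc, ← phase_add]
  simp [phase_zero]

/-- The lattice point of `aℤ × bℤ` with coordinates `p`. -/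
def lat (a b : ℝ) (p : ℤ × ℤ) : ℝ × ℝ := (a * p.1, b * p.2)

lemma lat_neg (a b : ℝ) (p : ℤ × ℤ) : lat a b (-p) = -lat a b p := by simp [lat]

lemma lat_add (a b : ℝ) (p q : ℤ × ℤ) : lat a b (p + q) = lat a b p + lat a b q := by
  simp [lat, mul_add]

/-- Time-frequency shifts along `aℤ × bℤ` commute with those along the adjoint lattice. -/
lemma tf_lat_comm {a b : ℝ} (ha : a ≠ 0) (hb : b ≠ 0) (p q : ℤ × ℤ) (f : L2) :
    tf (lat a b p) (tf (lat b⁻¹ a⁻¹ q) f) = tf (lat b⁻¹ a⁻¹ q) (tf (lat a b p) f) := by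
  have : (lat a b p).2 * (lat b⁻¹ a⁻¹ q).1 - (lat b⁻¹ a⁻¹ q).2 * (lat a b p).1
      = ((p.2 * q.1 - q.2 * p.1 : ℤ) : ℝ) := by
    simp only [lat]
    push_cast
    field_simp
  rw [tf_comm, this, phase_int, one_smul]

lemma norm_inner_tf_tf (w z : ℝ × ℝ) (g f : L2) :
    ‖⟪tf w (tf z g), f⟫_ℂ‖ = ‖⟪tf w g, tf (-z) f⟫_ℂ‖ := by
  rw [tf_comm, inner_smul_left, inner_tf_left z, norm_mul, norm_mul, RCLike.norm_conj,
    norm_phase, norm_phase, one_mul, one_mul]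

lemma norm_inner_tf_swap (z : ℝ × ℝ) (u f : L2) :
    ‖⟪tf z u, f⟫_ℂ‖ = ‖⟪tf (-z) f, u⟫_ℂ‖ := by
  rw [inner_tf_left, norm_mul, norm_phase, one_mul, norm_inner_symm]

lemma IsBessel.gabor_tf {a b C : ℝ} {g : L2} (h : IsBessel (fun p => tf (lat a b p) g) C)
    (z : ℝ × ℝ) : IsBessel (fun p => tf (lat a b p) (tf z g)) C :=
  ⟨h.nonneg, fun f F => by
    simp only [norm_inner_tf_tf]
    rw [← norm_tf (-z) f]
    exact h.sum_le _ F⟩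

/-- The Gabor system generated by `g` along `aℤ × bℤ` is a Bessel family. -/
def GaborBessel (a b : ℝ) (g : L2) : Prop := ∃ C, IsBessel (fun p => tf (lat a b p) g) C

lemma GaborBessel.tf {a b : ℝ} {g : L2} (h : GaborBessel a b g) (z : ℝ × ℝ) :
    GaborBessel a b (tf z g) := h.imp fun _ hC => hC.gabor_tf z

lemma GaborBessel.summable_function {a b : ℝ} {f : L2} (h : GaborBessel a b f) (u : L2) :
    Summable fun p => ‖⟪_root_.tf (lat a b p) u, f⟫_ℂ‖ ^ 2 := by
  have := (h.choose_spec.comp_injective neg_injective).summable u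
  refine this.congr fun p => ?_
  rw [norm_inner_tf_swap _ u f, lat_neg]

lemma isBessel_box {a b ε : ℝ} (hb : 0 < b) (hε : ε ≤ b⁻¹) (hεa : ε ≤ a) :
    IsBessel (fun p => tf (lat a b p) (box ε)) b⁻¹ := by
  have hb' := inv_pos.mpr hb
  refine IsBessel.of_hasSum_le hb'.le (fun f => hasSum_sq_inner_box hb hε hεa f) fun f => ?_
  rw [← integral_norm_sq_L2 f]
  refine mul_le_mul_of_nonneg_left ?_ hb'.le
  exact setIntegral_le_integral (integrable_norm_sq_L2 f)
    (Eventually.of_forall fun _ => by positivity)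

/-- For adjoint lattices, the analysis coefficients of a finite synthesis along `Λ°` are those
of a finite synthesis of the analysing window. -/
lemma norm_inner_tf_lat_sum {a b : ℝ} (ha : a ≠ 0) (hb : b ≠ 0) (η g : L2)
    (F : Finset (ℤ × ℤ)) (c : ℤ × ℤ → ℂ) (p : ℤ × ℤ) :
    ‖⟪tf (lat a b p) η, ∑ q ∈ F, c q • tf (lat b⁻¹ a⁻¹ q) g⟫_ℂ‖
      = ‖⟪tf (lat a b (-p)) g, ∑ q ∈ F,
          (conj (c q) * phase ((lat b⁻¹ a⁻¹ q).1 * (lat b⁻¹ a⁻¹ q).2)) •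
            tf (lat b⁻¹ a⁻¹ (-q)) η⟫_ℂ‖ := by
  rw [inner_tf_left, norm_mul, norm_phase, one_mul, ← norm_inner_symm, ← lat_neg]
  rw [← tfIso_apply, map_sum, sum_inner, inner_sum]
  congr 1
  refine Finset.sum_congr rfl fun q _ => ?_
  rw [tfIso_apply, tf_smul, tf_lat_comm ha hb, inner_smul_left, inner_smul_right,
    inner_tf_left (lat b⁻¹ a⁻¹ q), ← lat_neg, mul_assoc]

lemma IsBessel.adjoint_lattice {a b ε C : ℝ} (ha : 0 < a) (hb : 0 < b) {N : ℕ} (hN : N ≠ 0)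
    (hε : ε = a / N) (hεb : ε ≤ b⁻¹) {g : L2}
    (h : IsBessel (fun p => tf (lat a b p) g) C) :
    IsBessel (fun p => tf (lat b⁻¹ a⁻¹ p) g) (b * (N * (C * a))) := by
  have hC := h.nonneg
  have hN0 : (0 : ℝ) < N := by positivity
  have hN1 : (1 : ℝ) ≤ N := by exact_mod_cast Nat.one_le_iff_ne_zero.mpr hN
  have hε0 : 0 < ε := by rw [hε]; positivity
  have hεN : ε * N = a := by rw [hε]; field_simp
  have hεa : ε ≤ a := by nlinarith
  have : NeZero N := ⟨hN⟩
  refine IsBessel.of_norm_sum_smul_sq_le (by positivity) fun F c => ?_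
  set x := ∑ q ∈ F, c q • tf (lat b⁻¹ a⁻¹ q) g with hx
  let e : Fin N × (ℤ × ℤ) ≃ ℤ × ℤ := (Equiv.prodAssoc (Fin N) ℤ ℤ).symm.trans
    (((Equiv.prodComm _ _).trans (Int.divModEquiv N).symm).prodCongr (Equiv.refl ℤ))
  have he : ∀ i p, e (i, p) = (p.1 * N + (i : ℕ), p.2) := fun i p => rfl
  have hsum := e.hasSum_iff.mpr (hasSum_sq_inner_box_tight hb hε0 hεb x)
  have key : ∀ i : Fin N, ∑' p : ℤ × ℤ, ‖⟪tf (ε * (e (i, p)).1, b * (e (i, p)).2) (box ε), x⟫_ℂ‖ ^ 2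
      ≤ C * (a * ∑ q ∈ F, ‖c q‖ ^ 2) := fun i => by
    set η := tf (ε * (i : ℕ), 0) (box ε) with hη
    have h1 : ∀ p : ℤ × ℤ, ‖⟪tf (ε * (e (i, p)).1, b * (e (i, p)).2) (box ε), x⟫_ℂ‖
        = ‖⟪tf (lat a b p) η, x⟫_ℂ‖ := fun p => by
      have : lat a b p + (ε * (i : ℕ), 0) = (ε * (e (i, p)).1, b * (e (i, p)).2) := by
        rw [he, lat, ← hεN]
        ext
        · push_cast
          simp
          ring
        · simp
      rw [hη, tf_tf, this, inner_smul_left, norm_mul, RCLike.norm_conj, norm_phase, one_mul]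
    simp only [h1]
    simp only [hx, norm_inner_tf_lat_sum ha.ne' hb.ne']
    refine ((h.comp_injective neg_injective).tsum_le _).trans
      (mul_le_mul_of_nonneg_left ?_ hC)
    have hB := ((isBessel_box (inv_pos.mpr ha) (by rwa [inv_inv]) hεb).gabor_tf
      (ε * (i : ℕ), 0)).comp_injective neg_injective
    refine (hB.norm_sum_smul_sq_le F _).trans (le_of_eq ?_)
    simp [norm_phase]
  have hle : b⁻¹ * ‖x‖ ^ 2 ≤ N * (C * (a * ∑ q ∈ F, ‖c q‖ ^ 2)) := by
    rw [← hsum.tsum_eq, hsum.summable.tsum_prod, tsum_fintype]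
    refine (Finset.sum_le_sum fun i _ => key i).trans (le_of_eq ?_)
    simp
  calc ‖x‖ ^ 2 = b * (b⁻¹ * ‖x‖ ^ 2) := by field_simp
    _ ≤ b * (N * (C * (a * ∑ q ∈ F, ‖c q‖ ^ 2))) := by gcongr
    _ = _ := by ring

/-- The Bessel property passes to the adjoint lattice. -/
lemma GaborBessel.adjoint_lattice {a b : ℝ} (ha : 0 < a) (hb : 0 < b) {g : L2}
    (h : GaborBessel a b g) : GaborBessel b⁻¹ a⁻¹ g := by
  obtain ⟨C, hC⟩ := h
  obtain ⟨N, hN⟩ := exists_nat_ge (a * b)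
  have hN0 : 0 < (N : ℝ) := (mul_pos ha hb).trans_le hN
  refine ⟨_, hC.adjoint_lattice ha hb (N := N) (by exact_mod_cast hN0.ne') rfl ?_⟩
  rw [div_le_iff₀ hN0, inv_mul_eq_div, le_div_iff₀ hb]
  exact hN

/-- Measurable functions bounded by one and supported in `(c, c + ε]`. -/
structure IsBoxLike (u : ℝ → ℂ) (c ε : ℝ) : Prop where
  measurable : Measurable u
  norm_le : ∀ x, ‖u x‖ ≤ 1
  eq_zero : ∀ x, x ∉ Set.Ioc c (c + ε) → u x = 0

lemma exists_isBoxLike_tf_box (z : ℝ × ℝ) (ε : ℝ) :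
    ∃ u : ℝ → ℂ, tf z (box ε) =ᵐ[volume] u ∧ IsBoxLike u z.1 ε := by
  refine ⟨fun x => phase (z.2 * (x - z.1)) *
    (Set.Ioc (0 : ℝ) ε).indicator (fun _ => (1 : ℂ)) (x - z.1), ?_, ?_, fun x => ?_, fun x hx => ?_⟩
  · filter_upwards [tf_coe z (box ε), ae_comp_sub z.1 (box_coe ε)] with x h1 h2
    rw [h1, h2]
  · have h1 : Measurable fun x : ℝ => phase (z.2 * (x - z.1)) :=
      (continuous_phase.comp (by fun_prop)).measurable
    have h2 : Measurable ((Set.Ioc (0 : ℝ) ε).indicator fun _ => (1 : ℂ)) :=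
      measurable_const.indicator measurableSet_Ioc
    exact h1.mul (h2.comp (measurable_id.sub_const z.1))
  · rw [norm_mul, norm_phase, one_mul]
    exact (norm_indicator_le_norm_self _ _).trans (by simp)
  · rw [Set.indicator_of_notMem, mul_zero]
    exact fun h => hx ⟨by linarith [h.1], by linarith [h.2]⟩

lemma memLp_two_of_norm_le_one {φ : ℝ → ℂ} {c d : ℝ} (hm : Measurable φ) (hb : ∀ x, ‖φ x‖ ≤ 1)
    (hs : ∀ x, x ∉ Set.Ioc c d → φ x = 0) : MemLp φ 2 volume := by
  refine MemLp.of_le (memLp_indicator_const 2 (measurableSet_Ioc (a := c) (b := d)) (1 : ℂ)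
    (Or.inr measure_Ioc_lt_top.ne)) hm.aestronglyMeasurable (Eventually.of_forall fun x => ?_)
  by_cases hx : x ∈ Set.Ioc c d
  · simpa [hx] using hb x
  · simp [hs x hx]

lemma round_eq_of_abs_sub_lt {t : ℝ} {k : ℤ} (h : |t - k| < 1 / 2) : round t = k := by
  rw [round_eq, Int.floor_eq_iff]
  rw [abs_lt] at h
  constructor <;> linarith [h.1, h.2]

/-- Gabor coefficient sums of box-like functions collapse to a single integral. -/
lemma hasSum_inner_mul_inner_of_isBoxLike {a b ε : ℝ} (ha : 0 < a) (hb : 0 < b)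
    (hεa : 2 * ε ≤ a) (hεb : 2 * ε ≤ b⁻¹) {f u v h : L2} {f' u' v' h' : ℝ → ℂ}
    {cf cu cv ch : ℝ} (hf : f =ᵐ[volume] f') (hu : u =ᵐ[volume] u') (hv : v =ᵐ[volume] v')
    (hh : h =ᵐ[volume] h') (bf : IsBoxLike f' cf ε) (bu : IsBoxLike u' cu ε)
    (bv : IsBoxLike v' cv ε) (bh : IsBoxLike h' ch ε) :
    HasSum (fun p => ⟪tf (lat a b p) u, f⟫_ℂ * ⟪h, tf (lat a b p) v⟫_ℂ)
      (((b⁻¹ : ℝ) : ℂ) * ∫ x, conj (h' x) * v' (x - a * round ((ch - cv) / a)) *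
        f' (x - b⁻¹ * round ((ch - cf) / b⁻¹)) *
        conj (u' (x - a * round ((ch - cv) / a) - b⁻¹ * round ((ch - cf) / b⁻¹)))) := by
  set k₁ := round ((ch - cv) / a) with hk₁
  set j₁ := round ((ch - cf) / b⁻¹) with hj₁
  have hb' := inv_pos.mpr hb
  set G : ℤ → ℝ → ℂ := fun k x => conj (u' (x - a * k)) * f' x with hG
  set K : ℤ → ℝ → ℂ := fun k x => conj (v' (x - a * k)) * h' x with hK
  have hterm : ∀ p : ℤ × ℤ, ⟪tf (lat a b p) u, f⟫_ℂ * ⟪h, tf (lat a b p) v⟫_ℂ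
      = conj (∫ x, phase (-(b * p.2 * x)) * K p.1 x) * ∫ x, phase (-(b * p.2 * x)) * G p.1 x :=
    fun p => by
      have h1 : ⟪tf (lat a b p) u, f⟫_ℂ = phase ((lat a b p).1 * (lat a b p).2) *
          ∫ x, phase (-(b * p.2 * x)) * G p.1 x := inner_tf_eq_integral hu hf _
      have h2 : ⟪tf (lat a b p) v, h⟫_ℂ = phase ((lat a b p).1 * (lat a b p).2) *
          ∫ x, phase (-(b * p.2 * x)) * K p.1 x := inner_tf_eq_integral hv hh _
      rw [← inner_conj_symm h, h1, h2, map_mul]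
      linear_combination (conj (∫ x, phase (-(b * p.2 * x)) * K p.1 x) *
        ∫ x, phase (-(b * p.2 * x)) * G p.1 x) *
          conj_phase_mul_phase ((lat a b p).1 * (lat a b p).2)
  have hK0 : ∀ k, k ≠ k₁ → ∀ x, K k x = 0 := fun k hk x => by
    by_contra hne
    have h1 : x ∈ Set.Ioc ch (ch + ε) := by
      by_contra hx
      exact hne (by simp [hK, bh.eq_zero x hx])
    have h2 : x - a * k ∈ Set.Ioc cv (cv + ε) := by
      by_contra hx
      exact hne (by simp [hK, bv.eq_zero _ hx])
    refine hk (round_eq_of_abs_sub_lt ?_).symm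
    rw [div_sub' ha.ne', abs_div, abs_of_pos ha, div_lt_iff₀ ha, abs_lt]
    constructor <;> linarith [h1.1, h1.2, h2.1, h2.2]
  set F : ℝ → ℂ := fun x => G k₁ (x - b⁻¹ * j₁) with hF
  have hshift : ∀ l : ℤ, ∫ x, phase (-(b * l * x)) * G k₁ x
      = ∫ x, phase (-(b * l * x)) * F x := fun l => by
    rw [← integral_sub_right_eq_self (fun x => phase (-(b * l * x)) * G k₁ x) (b⁻¹ * j₁)]
    congr 1
    funext x
    have : -(b * l * (x - b⁻¹ * j₁)) = -(b * l * x) + ((l * j₁ : ℤ) : ℝ) := by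
      push_cast
      field_simp
      ring
    rw [this, phase_add, phase_int, mul_one]
  have hround : |ch - cf - b⁻¹ * j₁| ≤ b⁻¹ / 2 := by
    have := abs_sub_round ((ch - cf) / b⁻¹)
    rw [← hj₁, div_sub' hb'.ne', abs_div, abs_of_pos hb', div_le_iff₀ hb'] at this
    linarith
  rw [abs_le] at hround
  set c := min ch (cf + b⁻¹ * j₁) with hc
  have sK : ∀ x, x ∉ Set.Ioc c (c + b⁻¹) → K k₁ x = 0 := fun x hx => by
    rw [hK]
    simp only
    rw [bh.eq_zero x, mul_zero]
    refine fun h => hx ⟨(min_le_left _ _).trans_lt h.1, h.2.trans ?_⟩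
    rcases min_choice ch (cf + b⁻¹ * j₁) with hm | hm <;> rw [hc, hm] <;> linarith
  have sF : ∀ x, x ∉ Set.Ioc c (c + b⁻¹) → F x = 0 := fun x hx => by
    rw [hF]
    simp only [hG]
    rw [bf.eq_zero (x - b⁻¹ * j₁), mul_zero]
    refine fun h => hx ⟨(min_le_right _ _).trans_lt (by linarith [h.1]), ?_⟩
    rcases min_choice ch (cf + b⁻¹ * j₁) with hm | hm <;> rw [hc, hm] <;> linarith [h.2]
  have mK : MemLp (K k₁) 2 volume := by
    refine memLp_two_of_norm_le_one ?_ (fun x => ?_) sK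
    · exact (Complex.continuous_conj.measurable.comp
        (bv.measurable.comp (measurable_id.sub_const _))).mul bh.measurable
    · rw [hK]
      simp only
      rw [norm_mul, RCLike.norm_conj]
      exact mul_le_one₀ (bv.norm_le _) (norm_nonneg _) (bh.norm_le _)
  have mF : MemLp F 2 volume := by
    refine memLp_two_of_norm_le_one ?_ (fun x => ?_) sF
    · exact ((Complex.continuous_conj.measurable.comp
        (bu.measurable.comp (measurable_id.sub_const _))).mul bf.measurable).comp
          (measurable_id.sub_const _)
    · rw [hF]
      simp only [hG]
      rw [norm_mul, RCLike.norm_conj]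
      exact mul_le_one₀ (bu.norm_le _) (norm_nonneg _) (bf.norm_le _)
  have key := hasSum_conj_integral_mul_integral hb c mF mK sF sK
  have hinj : Function.Injective fun l : ℤ => (k₁, l) := fun _ _ h => (Prod.ext_iff.mp h).2
  rw [← hinj.hasSum_iff]
  · convert key using 1
    · funext l
      rw [← hshift l]
      exact hterm (k₁, l)
    · congr 2
      funext x
      rw [hK, hF, hG]
      simp only [map_mul, Complex.conj_conj, sub_right_comm x (a * k₁)]
      ring
  · rintro ⟨k, l⟩ hkl
    have hk : k ≠ k₁ := fun h => hkl ⟨l, by rw [h]⟩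
    rw [hterm]
    simp [hK0 k hk]

/-- The form `∑_λ ⟨f, π(λ)u⟩ ⟨π(λ)v, h⟩` over `aℤ × bℤ`. -/
def gaborForm (a b : ℝ) (f u v h : L2) : ℂ :=
  ∑' p, ⟪tf (lat a b p) u, f⟫_ℂ * ⟪h, tf (lat a b p) v⟫_ℂ

lemma conj_gaborForm (a b : ℝ) (f u v h : L2) :
    conj (gaborForm a b f u v h) = gaborForm a b h v u f := by
  rw [gaborForm, conj_tsum]
  refine tsum_congr fun p => ?_
  rw [map_mul, inner_conj_symm, inner_conj_symm, mul_comm]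

lemma gaborForm_neg (a b : ℝ) (f u v h : L2) :
    gaborForm a b f u v h = gaborForm a b v h f u := by
  rw [gaborForm, ← (Equiv.neg (ℤ × ℤ)).tsum_eq]
  refine tsum_congr fun p => ?_
  rw [Equiv.neg_apply, lat_neg, inner_tf_left (-lat a b p), inner_tf_right (-lat a b p),
    neg_neg]
  set t := (-lat a b p).1 * (-lat a b p).2
  have := conj_phase_mul_phase t
  rw [conj_phase] at this
  linear_combination ⟪u, tf (lat a b p) f⟫_ℂ * ⟪tf (lat a b p) h, v⟫_ℂ * this

/-- The fundamental identity of Gabor analysis for the quadruple `(f, u, v, h)`. -/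
def Figa (a b : ℝ) (f u v h : L2) : Prop :=
  gaborForm a b f u v h = (((a * b)⁻¹ : ℝ) : ℂ) * gaborForm b⁻¹ a⁻¹ v u f h

lemma Figa.conj_symm {a b : ℝ} {f u v h : L2} (H : Figa a b f u v h) : Figa a b h v u f := by
  have H' := congrArg conj H
  rwa [map_mul, conj_gaborForm, conj_gaborForm, Complex.conj_ofReal,
    gaborForm_neg b⁻¹ a⁻¹] at H'

lemma Figa.neg_symm {a b : ℝ} {f u v h : L2} (H : Figa a b f u v h) : Figa a b v h f u := by
  rwa [Figa, gaborForm_neg, gaborForm_neg b⁻¹ a⁻¹] at H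

lemma hasSum_gaborForm {a b : ℝ} {f u v S : L2}
    (hS : HasSum (fun p => ⟪tf (lat a b p) u, f⟫_ℂ • tf (lat a b p) v) S) (h : L2) :
    gaborForm a b f u v h = ⟪h, S⟫_ℂ := by
  refine HasSum.tsum_eq ?_
  refine ((innerSL ℂ h).hasSum hS).of_forall_eq fun p => ?_
  simp

lemma Figa.of_forall_box {a b ε : ℝ} (hb : 0 < b) (hε : 0 < ε) (hεb : ε ≤ b⁻¹) {f u v : L2}
    (hf : GaborBessel a b f) (hf' : GaborBessel b⁻¹ a⁻¹ f) (hv : GaborBessel a b v)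
    (hv' : GaborBessel b⁻¹ a⁻¹ v) (H : ∀ z, Figa a b f u v (tf z (box ε))) (h : L2) :
    Figa a b f u v h := by
  obtain ⟨S, hS⟩ := hv.choose_spec.summable_smul (hf.summable_function u)
  obtain ⟨T, hT⟩ := hf'.choose_spec.summable_smul (hv'.summable_function u)
  have hST : S = (((a * b)⁻¹ : ℝ) : ℂ) • T := by
    refine eq_of_inner_box_eq hb hε hεb fun z => ?_
    rw [inner_smul_right, ← hasSum_gaborForm hS, ← hasSum_gaborForm hT]
    exact H z
  rw [Figa, hasSum_gaborForm hS, hasSum_gaborForm hT, hST, inner_smul_right]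

lemma figa_box {a b ε : ℝ} (ha : 0 < a) (hb : 0 < b) (hεa : 2 * ε ≤ a) (hεb : 2 * ε ≤ b⁻¹)
    (z₁ z₂ z₃ z₄ : ℝ × ℝ) :
    Figa a b (tf z₁ (box ε)) (tf z₂ (box ε)) (tf z₃ (box ε)) (tf z₄ (box ε)) := by
  obtain ⟨f, hf, bf⟩ := exists_isBoxLike_tf_box z₁ ε
  obtain ⟨u, hu, bu⟩ := exists_isBoxLike_tf_box z₂ ε
  obtain ⟨v, hv, bv⟩ := exists_isBoxLike_tf_box z₃ ε
  obtain ⟨h, hh, bh⟩ := exists_isBoxLike_tf_box z₄ ε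
  have h1 := hasSum_inner_mul_inner_of_isBoxLike ha hb hεa hεb hf hu hv hh bf bu bv bh
  have h2 := hasSum_inner_mul_inner_of_isBoxLike (inv_pos.mpr hb) (inv_pos.mpr ha) hεb
    (by rwa [inv_inv]) hv hu hf hh bv bu bf bh
  rw [Figa, gaborForm, gaborForm, h1.tsum_eq, h2.tsum_eq]
  simp only [inv_inv]
  rw [← mul_assoc, ← Complex.ofReal_mul, show (a * b)⁻¹ * a = b⁻¹ by field_simp]
  congr 2
  funext x
  rw [sub_right_comm x (b⁻¹ * _)]
  ring

/-- The fundamental identity of Gabor analysis for Bessel windows. -/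
lemma figa_of_gaborBessel {a b : ℝ} (ha : 0 < a) (hb : 0 < b) {f u v : L2}
    (hf : GaborBessel a b f) (hu : GaborBessel a b u) (hv : GaborBessel a b v) (h : L2) :
    Figa a b f u v h := by
  have hb' := inv_pos.mpr hb
  set ε := min a b⁻¹ / 2 with hε
  have hm : 0 < min a b⁻¹ := lt_min ha hb'
  have hε0 : 0 < ε := by positivity
  have hεa : 2 * ε ≤ a := by linarith [min_le_left a b⁻¹]
  have hεb : 2 * ε ≤ b⁻¹ := by linarith [min_le_right a b⁻¹]
  have hεb' : ε ≤ b⁻¹ := by linarith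
  have y : ∀ z, GaborBessel a b (tf z (box ε)) := fun z =>
    GaborBessel.tf ⟨_, isBessel_box hb hεb' (by linarith)⟩ z
  have adj : ∀ {w : L2}, GaborBessel a b w → GaborBessel b⁻¹ a⁻¹ w := fun hw =>
    hw.adjoint_lattice ha hb
  have fill : ∀ {f u v : L2}, GaborBessel a b f → GaborBessel a b v →
      (∀ z, Figa a b f u v (tf z (box ε))) → ∀ h, Figa a b f u v h := fun hf hv H =>
    Figa.of_forall_box hb hε0 hεb' hf (adj hf) hv (adj hv) H
  have s1 : ∀ z₁ z₂ z₃ h, Figa a b (tf z₁ (box ε)) (tf z₂ (box ε)) (tf z₃ (box ε)) h :=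
    fun z₁ z₂ z₃ => fill (y _) (y _) (figa_box ha hb hεa hεb z₁ z₂ z₃)
  have s2 : ∀ f, GaborBessel a b f → ∀ z₂ z₃ h, Figa a b f (tf z₂ (box ε)) (tf z₃ (box ε)) h :=
    fun f hf z₂ z₃ => fill hf (y _) fun z => (s1 z z₃ z₂ f).conj_symm
  have s3 : ∀ v, GaborBessel a b v → ∀ z₁ u h, Figa a b (tf z₁ (box ε)) u v h :=
    fun v hv z₁ u => fill (y _) hv fun z => (s2 v hv z z₁ u).neg_symm
  exact fill hf hv (fun z => (s3 u hu z v f).conj_symm) h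

section FrameSequence

variable {ι H : Type*} [NormedAddCommGroup H] [InnerProductSpace ℂ H]
lemma IsBessel.of_frame_bounds [CompleteSpace H] {e : ι → H} {A B : ℝ} (hA : 0 < A) (hB : 0 < B)
    (h : ∀ f ∈ (Submodule.span ℂ (Set.range e)).topologicalClosure,
      A * ‖f‖ ^ 2 ≤ ∑' i, ‖⟪e i, f⟫_ℂ‖ ^ 2 ∧ ∑' i, ‖⟪e i, f⟫_ℂ‖ ^ 2 ≤ B * ‖f‖ ^ 2) :
    IsBessel e B := by
  set G := (Submodule.span ℂ (Set.range e)).topologicalClosure with hG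
  have hGc : IsClosed (G : Set H) := Submodule.isClosed_topologicalClosure _
  have : CompleteSpace G := hGc.completeSpace_coe
  have he : ∀ i, e i ∈ G := fun i =>
    Submodule.le_topologicalClosure _ (Submodule.subset_span ⟨i, rfl⟩)
  refine ⟨hB.le, fun f F => ?_⟩
  set x := G.starProjection f with hx
  have hxG : x ∈ G := G.starProjection_apply_mem f
  have h1 : ∀ i, ⟪e i, f⟫_ℂ = ⟪e i, x⟫_ℂ := fun i => by
    have := Submodule.sub_starProjection_mem_orthogonal (K := G) f
    have h2 := (Submodule.mem_orthogonal _ _).mp this (e i) (he i)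
    rwa [inner_sub_right, sub_eq_zero] at h2
  have hxf : ‖x‖ ≤ ‖f‖ := G.norm_starProjection_apply_le f
  simp only [h1]
  rcases eq_or_ne x 0 with h0 | h0
  · simp only [h0, inner_zero_right, norm_zero, zero_pow two_ne_zero, Finset.sum_const_zero]
    positivity
  · have hs : Summable fun i => ‖⟪e i, x⟫_ℂ‖ ^ 2 := by
      by_contra hns
      have := (h x hxG).1
      rw [tsum_eq_zero_of_not_summable hns] at this
      have : 0 < A * ‖x‖ ^ 2 := by positivity
      linarith
    calc _ ≤ ∑' i, ‖⟪e i, x⟫_ℂ‖ ^ 2 := hs.sum_le_tsum F fun _ _ => by positivity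
      _ ≤ B * ‖x‖ ^ 2 := (h x hxG).2
      _ ≤ B * ‖f‖ ^ 2 := by gcongr

lemma hasSum_conj_inner_mul_inner {e d : ι → H} {f x : H}
    (h : HasSum (fun i => ⟪e i, f⟫_ℂ • d i) x) (y : H) :
    HasSum (fun i => ⟪f, e i⟫_ℂ * ⟪d i, y⟫_ℂ) ⟪x, y⟫_ℂ := by
  have h1 := ((innerSL ℂ y).hasSum h).map (starRingEnd ℂ) Complex.continuous_conj
  simp only [innerSL_apply_apply, inner_conj_symm] at h1
  refine h1.of_forall_eq fun i => ?_
  simp [inner_smul_right]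

/-- The canonical dual of a frame sequence is a Bessel family, and both reconstruction formulas
hold on the closed linear span. -/
lemma exists_isBessel_canonical_dual [CompleteSpace H] {e d : ι → H} {A B : ℝ} (hA : 0 < A) (hB : 0 < B)
    (h : ∀ f ∈ (Submodule.span ℂ (Set.range e)).topologicalClosure,
      A * ‖f‖ ^ 2 ≤ ∑' i, ‖⟪e i, f⟫_ℂ‖ ^ 2 ∧ ∑' i, ‖⟪e i, f⟫_ℂ‖ ^ 2 ≤ B * ‖f‖ ^ 2)
    (hd : ∀ i, d i ∈ (Submodule.span ℂ (Set.range e)).topologicalClosure)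
    (hde : ∀ i, HasSum (fun j => ⟪e j, d i⟫_ℂ • e j) (e i)) :
    (∃ C, IsBessel d C) ∧ (∀ i j, ⟪d i, e j⟫_ℂ = ⟪e i, d j⟫_ℂ) ∧
    ∀ f ∈ (Submodule.span ℂ (Set.range e)).topologicalClosure,
      HasSum (fun i => ⟪e i, f⟫_ℂ • d i) f ∧ HasSum (fun i => ⟪d i, f⟫_ℂ • e i) f := by
  have hBes := IsBessel.of_frame_bounds hA hB h
  set G := (Submodule.span ℂ (Set.range e)).topologicalClosure with hG
  have hGc : IsClosed (G : Set H) := Submodule.isClosed_topologicalClosure _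
  have : CompleteSpace G := hGc.completeSpace_coe
  have he : ∀ i, e i ∈ G := fun i =>
    Submodule.le_topologicalClosure _ (Submodule.subset_span ⟨i, rfl⟩)
  obtain ⟨S, hS⟩ := hBes.exists_mixed_frame_operator hBes
  have hSG : ∀ f, S f ∈ G := fun f =>
    hGc.mem_of_tendsto (hS f) (Eventually.of_forall fun F =>
      G.sum_mem fun i _ => G.smul_mem _ (he i))
  set Q : H →L[ℂ] H := ContinuousLinearMap.id ℂ H - G.starProjection with hQ
  have hQa : ∀ f, Q f = f - G.starProjection f := fun f => rfl
  have hQo : ∀ f, ∀ w ∈ G, ⟪w, Q f⟫_ℂ = 0 := fun f w hw => by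
    rw [hQa]
    exact (Submodule.mem_orthogonal _ _).mp
      (Submodule.sub_starProjection_mem_orthogonal (K := G) f) w hw
  have hQG : ∀ f ∈ G, Q f = 0 := fun f hf => by
    rw [hQa, Submodule.starProjection_eq_self_iff.mpr hf, sub_self]
  have hSs : ∀ f w, ⟪S f, w⟫_ℂ = ⟪f, S w⟫_ℂ := fun f w => by
    have h1 := hasSum_conj_inner_mul_inner (hS f) w
    refine h1.unique (((innerSL ℂ f).hasSum (hS w)).of_forall_eq fun i => ?_)
    simp [mul_comm]
  have hQs : ∀ f w, ⟪Q f, w⟫_ℂ = ⟪f, Q w⟫_ℂ := fun f w => by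
    rw [hQa, hQa, inner_sub_left, inner_sub_right, Submodule.inner_starProjection_left_eq_right]
  set T := S + Q with hT
  have hTs : ∀ f w, ⟪T f, w⟫_ℂ = ⟪f, T w⟫_ℂ := fun f w => by
    simp only [hT, _root_.add_apply, inner_add_left, inner_add_right, hSs, hQs]
  have hlow : ∀ x, ‖x‖ ^ 2 * min A 1 ≤ ‖⟪T x, x⟫_ℂ‖ := fun x => by
    set y := G.starProjection x with hy
    have hyG : y ∈ G := G.starProjection_apply_mem x
    have hxy : x = y + Q x := by rw [hQa, ← hy]; abel
    have hey : ∀ i, ⟪e i, x⟫_ℂ = ⟪e i, y⟫_ℂ := fun i => by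
      conv_lhs => rw [hxy, inner_add_right, hQo x _ (he i), add_zero]
    have h1 : ⟪S x, x⟫_ℂ = ((∑' i, ‖⟪e i, x⟫_ℂ‖ ^ 2 : ℝ) : ℂ) := by
      refine (hasSum_conj_inner_mul_inner (hS x) x).unique ?_
      refine ((Complex.hasSum_ofReal.mpr (hBes.summable x).hasSum)).of_forall_eq fun i => ?_
      rw [← inner_conj_symm x, Complex.conj_mul']
      push_cast
      rfl
    have h2 : ⟪Q x, x⟫_ℂ = ((‖Q x‖ ^ 2 : ℝ) : ℂ) := by
      conv_lhs => rw [hxy, inner_add_right, ← hxy, ← inner_conj_symm, hQo x y hyG, map_zero,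
        zero_add, inner_self_eq_norm_sq_to_K]
      push_cast
      rfl
    have h3 : ‖x‖ ^ 2 = ‖y‖ ^ 2 + ‖Q x‖ ^ 2 := by
      have := norm_add_sq_eq_norm_sq_add_norm_sq_of_inner_eq_zero y (Q x) (hQo x y hyG)
      rw [← hxy] at this
      nlinarith
    have h4 : A * ‖y‖ ^ 2 ≤ ∑' i, ‖⟪e i, x⟫_ℂ‖ ^ 2 := by
      simp only [hey]
      exact (h y hyG).1
    rw [hT, _root_.add_apply, inner_add_left, h1, h2, ← Complex.ofReal_add, Complex.norm_real,
      Real.norm_of_nonneg (add_nonneg (tsum_nonneg fun _ => by positivity) (by positivity)), h3]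
    nlinarith [min_le_left A 1, min_le_right A 1, sq_nonneg ‖y‖, sq_nonneg ‖Q x‖]
  have hunit : IsUnit T := ContinuousLinearMap.isUnit_of_forall_le_norm_inner_map T
    (c := ⟨min A 1, (lt_min hA one_pos).le⟩) (lt_min hA one_pos) hlow
  obtain ⟨R, hTR, hRT⟩ := isUnit_iff_exists.mp hunit
  replace hTR : ∀ f, T (R f) = f := fun f => DFunLike.congr_fun hTR f
  replace hRT : ∀ f, R (T f) = f := fun f => DFunLike.congr_fun hRT f
  have hTG : ∀ f ∈ G, T f = S f := fun f hf => by
    rw [hT, _root_.add_apply, hQG f hf, add_zero]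
  have hRs : ∀ f w, ⟪R f, w⟫_ℂ = ⟪f, R w⟫_ℂ := fun f w => by
    rw [← hTR w, ← hTs, hTR, hTR]
  have hRG : ∀ f ∈ G, R f ∈ G := fun f hf => by
    have h1 : S (R f) + Q (R f) = f := hTR f
    have h2 : Q (R f) ∈ G := by
      rw [← eq_sub_iff_add_eq'] at h1
      rw [h1]
      exact G.sub_mem hf (hSG _)
    have h3 : Q (R f) = 0 := inner_self_eq_zero.mp (hQo (R f) _ h2)
    rw [hQa, sub_eq_zero] at h3
    rw [h3]
    exact G.starProjection_apply_mem _
  have hRe : ∀ i, R (e i) = d i := fun i => by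
    rw [← (hS (d i)).unique (hde i), ← hTG _ (hd i), hRT]
  refine ⟨⟨B * ‖R‖ ^ 2, by positivity, fun f F => ?_⟩,
    fun i j => by rw [← hRe, ← hRe, hRs], fun f hf => ⟨?_, ?_⟩⟩
  · simp only [← hRe, hRs]
    refine (hBes.sum_le (R f) F).trans ?_
    rw [mul_assoc, ← mul_pow]
    have := R.le_opNorm f
    gcongr
  · have h1 := R.hasSum (hS f)
    rw [← hTG f hf, hRT] at h1
    refine h1.of_forall_eq fun i => ?_
    rw [map_smul, hRe]
  · have h1 := hS (R f)
    rw [← hTG _ (hRG f hf), hTR] at h1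
    refine h1.of_forall_eq fun i => ?_
    rw [← hRs, hRe]

end FrameSequence

lemma map_mem_of_mem_closure_span {s : Set L2} {K : Submodule ℂ L2} (hK : IsClosed (K : Set L2))
    (U : L2 →L[ℂ] L2) (h : ∀ x ∈ s, U x ∈ K) {f : L2}
    (hf : f ∈ (Submodule.span ℂ s).topologicalClosure) : U f ∈ K := by
  have h1 : Submodule.span ℂ s ≤ K.comap (U : L2 →ₗ[ℂ] L2) := Submodule.span_le.mpr h
  exact Submodule.topologicalClosure_minimal _ h1 (hK.preimage U.continuous) hf

/-- The coordinates of the lattice `αℤ × βℤ`. -/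
def latEquiv {α β : ℝ} (hα : α ≠ 0) (hβ : β ≠ 0) : ℤ × ℤ ≃ sepLattice α β :=
  Equiv.ofBijective (fun p => ⟨lat α β p, p.1, p.2, rfl⟩) ⟨fun p q h => by
    have h1 := congrArg Subtype.val h
    simp only [lat, Prod.mk.injEq, mul_right_inj' hα, mul_right_inj' hβ, Int.cast_inj] at h1
    exact Prod.ext h1.1 h1.2, by
    rintro ⟨_, k, l, rfl⟩
    exact ⟨(k, l), rfl⟩⟩

/-- The closed linear span of the Gabor system along `aℤ × bℤ`. -/
def gaborSub (a b : ℝ) (g : L2) : Submodule ℂ L2 :=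
  (Submodule.span ℂ (Set.range fun p => tf (lat a b p) g)).topologicalClosure

lemma isClosed_gaborSub (a b : ℝ) (g : L2) : IsClosed (gaborSub a b g : Set L2) :=
  Submodule.isClosed_topologicalClosure _

lemma tf_mem_gaborSub (a b : ℝ) (g : L2) (p : ℤ × ℤ) : tf (lat a b p) g ∈ gaborSub a b g :=
  Submodule.le_topologicalClosure _ (Submodule.subset_span ⟨p, rfl⟩)

lemma coe_gaborSub (a b : ℝ) (g : L2) :
    (gaborSub a b g : Set L2) = gaborSpan g (sepLattice a b) := by
  have : (Set.range fun p => tf (lat a b p) g) = (fun z => tf z g) '' sepLattice a b := by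
    ext f
    constructor
    · rintro ⟨p, rfl⟩
      exact ⟨_, ⟨p.1, p.2, rfl⟩, rfl⟩
    · rintro ⟨_, ⟨k, l, rfl⟩, rfl⟩
      exact ⟨(k, l), rfl⟩
  rw [gaborSub, Submodule.topologicalClosure_coe, this, gaborSpan]

lemma tf_mem_gaborSub_of_window {a b : ℝ} {g : L2} {z : ℝ × ℝ} (hz : ∀ p, tf z (tf (lat a b p) g) ∈
    gaborSub a b g) {f : L2} (hf : f ∈ gaborSub a b g) : tf z f ∈ gaborSub a b g :=
  map_mem_of_mem_closure_span (isClosed_gaborSub a b g) (tfIso z).toContinuousLinearMap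
    (by rintro _ ⟨p, rfl⟩; exact hz p) hf

lemma tf_lat_mem_gaborSub {a b : ℝ} {g f : L2} (hf : f ∈ gaborSub a b g) (p : ℤ × ℤ) :
    tf (lat a b p) f ∈ gaborSub a b g :=
  tf_mem_gaborSub_of_window (fun q => by
    rw [tf_tf, ← lat_add]
    exact Submodule.smul_mem _ _ (tf_mem_gaborSub a b g _)) hf

/-- A translation moving the window into the Gabor space leaves the Gabor space invariant. -/
lemma tf_mem_gaborSub_of_mem {a b : ℝ} {g : L2} {z : ℝ × ℝ} (hz : tf z g ∈ gaborSub a b g)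
    {f : L2} (hf : f ∈ gaborSub a b g) : tf z f ∈ gaborSub a b g :=
  tf_mem_gaborSub_of_window (fun p => by
    rw [tf_comm]
    exact Submodule.smul_mem _ _ (tf_lat_mem_gaborSub hz p)) hf

lemma tf_neg_mem_gaborSub {a b : ℝ} {g : L2} {ν : ℕ} (hν : 1 ≤ ν)
    (h : tf (a / ν, 0) g ∈ gaborSub a b g) {f : L2} (hf : f ∈ gaborSub a b g) :
    tf (-(a / ν, 0)) f ∈ gaborSub a b g := by
  have hν0 : (ν : ℝ) ≠ 0 := by positivity
  have hn : ∀ n : ℕ, tf (n * (a / ν), 0) f ∈ gaborSub a b g := fun n => by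
    induction n with
    | zero => simpa [← Prod.zero_eq_mk, tf_zero] using hf
    | succ n ih =>
      have := tf_mem_gaborSub_of_mem h ih
      rw [tf_tf] at this
      convert this using 1
      simp [phase_zero]
      ring_nf
  have h1 := tf_lat_mem_gaborSub (hn (ν - 1)) (-1, 0)
  rw [tf_tf] at h1
  convert h1 using 1
  have : lat a b (-1, 0) + (((ν - 1 : ℕ) : ℝ) * (a / ν), 0) = -(a / ν, 0) := by
    rw [Nat.cast_sub hν, lat]
    ext
    · simp
      field_simp
      ring
    · simp
  rw [this]
  simp [lat, phase_zero]

lemma hasSum_inner_tf_smul_tf {a b : ℝ} {f u v S : L2}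
    (h : HasSum (fun q => ⟪tf (lat a b q) u, f⟫_ℂ • tf (lat a b q) v) S) (p : ℤ × ℤ) :
    HasSum (fun q => ⟪tf (lat a b q) u, tf (lat a b p) f⟫_ℂ • tf (lat a b q) v)
      (tf (lat a b p) S) := by
  rw [← (Equiv.addLeft p).hasSum_iff]
  refine ((tfIso (lat a b p)).toContinuousLinearMap.hasSum h).of_forall_eq fun q => ?_
  have h1 : ∀ w, tf (lat a b p) (tf (lat a b q) w)
      = phase ((lat a b p).2 * (lat a b q).1) • tf (lat a b (p + q)) w := fun w => by
    rw [tf_tf, lat_add]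
  rw [map_smul, Function.comp_apply, Equiv.coe_addLeft, ← inner_tf_tf (lat a b p), h1]
  change _ • tf _ _ = _
  rw [h1, inner_phase_smul_smul]

/-- Bessel property of a frame sequence and of its canonical dual, with the reconstruction
formulas on the Gabor space. -/
lemma IsFrameSeq.canonical_dual {g γ : L2} {α β : ℝ} (hα : α ≠ 0) (hβ : β ≠ 0)
    (hframe : IsFrameSeq g (sepLattice α β)) (hγ : IsDualWindow g γ α β) :
    GaborBessel α β g ∧ GaborBessel α β γ ∧
    (∀ p, ⟪tf (lat α β p) γ, g⟫_ℂ = ⟪tf (lat α β p) g, γ⟫_ℂ) ∧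
    ∀ f ∈ gaborSub α β g,
      HasSum (fun p => ⟪tf (lat α β p) g, f⟫_ℂ • tf (lat α β p) γ) f ∧
      HasSum (fun p => ⟪tf (lat α β p) γ, f⟫_ℂ • tf (lat α β p) g) f := by
  obtain ⟨A, B, hA, hB, hAB⟩ := hframe
  obtain ⟨hγG, hγS⟩ := hγ
  rw [← coe_gaborSub] at hγG hAB
  have hAB' : ∀ f ∈ gaborSub α β g, A * ‖f‖ ^ 2 ≤ ∑' p, ‖⟪tf (lat α β p) g, f⟫_ℂ‖ ^ 2 ∧
      ∑' p, ‖⟪tf (lat α β p) g, f⟫_ℂ‖ ^ 2 ≤ B * ‖f‖ ^ 2 := fun f hf => by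
    have := hAB f hf
    rwa [← (latEquiv hα hβ).tsum_eq] at this
  rw [← (latEquiv hα hβ).hasSum_iff] at hγS
  obtain ⟨h1, h2, h3⟩ := exists_isBessel_canonical_dual hA hB hAB'
    (fun p => tf_lat_mem_gaborSub hγG p) (fun p => hasSum_inner_tf_smul_tf hγS p)
  refine ⟨⟨B, IsBessel.of_frame_bounds hA hB hAB'⟩, h1, fun p => ?_, h3⟩
  have := h2 p 0
  simpa [lat, ← Prod.zero_eq_mk, tf_zero] using this

lemma exists_int_of_phase_eq_one {t : ℝ} (h : phase t = 1) : ∃ n : ℤ, t = n := by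
  rw [phase, Complex.exp_eq_one_iff] at h
  obtain ⟨n, hn⟩ := h
  refine ⟨n, ?_⟩
  have h2 : (2 * Real.pi * Complex.I : ℂ) ≠ 0 := Complex.two_pi_I_ne_zero
  have : ((t : ℝ) : ℂ) = ((n : ℝ) : ℂ) := mul_left_cancel₀ h2 (by rw [hn]; push_cast; ring)
  exact Complex.ofReal_injective this

/-- Off the sublattice `β⁻¹ℤ × (ν/α)ℤ`, the adjoint-lattice Gabor coefficients of the window with
respect to its dual vanish. -/
lemma inner_tf_dual_window_eq_zero {g γ : L2} {α β : ℝ} (hα : 0 < α) (hβ : 0 < β)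
    (hγ : γ ∈ gaborSub α β g)
    (hrec : ∀ f ∈ gaborSub α β g,
      HasSum (fun p => ⟪tf (lat α β p) g, f⟫_ℂ • tf (lat α β p) γ) f ∧
      HasSum (fun p => ⟪tf (lat α β p) γ, f⟫_ℂ • tf (lat α β p) g) f)
    {ν : ℕ} (hν : 1 ≤ ν) (hshift : tf (α / ν, 0) g ∈ gaborSub α β g) {q : ℤ × ℤ}
    (hq : ¬ (ν : ℤ) ∣ q.2) : ⟪tf (lat β⁻¹ α⁻¹ q) γ, g⟫_ℂ = 0 := by
  have hν0 : (ν : ℝ) ≠ 0 := by positivity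
  set t : ℝ × ℝ := (α / ν, 0) with ht
  set μ := lat β⁻¹ α⁻¹ q with hμ
  have h1 : HasSum (fun p => ⟪tf (lat α β p) γ, tf t g⟫_ℂ * ⟪tf μ (tf t γ), tf (lat α β p) g⟫_ℂ)
      ⟪tf μ (tf t γ), tf t g⟫_ℂ :=
    ((innerSL ℂ (tf μ (tf t γ))).hasSum (hrec _ hshift).2).of_forall_eq fun p => by simp
  have h2 : HasSum (fun p => ⟪tf (lat α β p) g, tf (-t) γ⟫_ℂ • tf μ (tf t (tf (lat α β p) γ)))
      (tf μ γ) := by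
    have h3 := ((tfIso μ).toContinuousLinearMap.hasSum ((tfIso t).toContinuousLinearMap.hasSum
      (hrec _ (tf_neg_mem_gaborSub hν hshift hγ)).1))
    have h4 : tf t (tf (-t) γ) = γ := by rw [tf_tf_neg, ht]; simp [phase_zero]
    have h5 : (tfIso μ).toContinuousLinearMap ((tfIso t).toContinuousLinearMap (tf (-t) γ))
        = tf μ γ := congrArg (tf μ) h4
    rw [← ht, h5] at h3
    refine h3.of_forall_eq fun p => ?_
    rw [map_smul, map_smul]
    rfl
  have h3 := hasSum_conj_inner_mul_inner h2 g
  rw [← (Equiv.neg (ℤ × ℤ)).hasSum_iff] at h3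
  have hterm : ∀ p, ⟪tf (-t) γ, tf (lat α β (-p)) g⟫_ℂ * ⟪tf μ (tf t (tf (lat α β (-p)) γ)), g⟫_ℂ
      = ⟪tf (lat α β p) γ, tf t g⟫_ℂ * ⟪tf μ (tf t γ), tf (lat α β p) g⟫_ℂ := fun p => by
    have e1 : ⟪tf (-t) γ, tf (lat α β (-p)) g⟫_ℂ
        = phase (-((lat α β p).1 * (lat α β p).2)) * (phase ((lat α β p).2 * t.1) *
          ⟪tf (lat α β p) γ, tf t g⟫_ℂ) := by
      rw [inner_tf_right, ← lat_neg, neg_neg, tf_comm _ (-t), inner_smul_left,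
        inner_tf_left (-t), neg_neg, conj_phase, lat_neg]
      simp [ht, phase_zero]
    have e2 : ⟪tf μ (tf t (tf (lat α β (-p)) γ)), g⟫_ℂ
        = phase (-((lat α β p).2 * t.1)) * (phase ((lat α β p).1 * (lat α β p).2) *
          ⟪tf μ (tf t γ), tf (lat α β p) g⟫_ℂ) := by
      rw [tf_comm t, tf_smul, hμ, ← tf_lat_comm hα.ne' hβ.ne', inner_smul_left,
        inner_tf_left (lat α β (-p)), ← lat_neg, neg_neg, conj_phase, lat_neg]
      simp [ht]
    have c1 := conj_phase_mul_phase ((lat α β p).1 * (lat α β p).2)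
    have c2 := conj_phase_mul_phase ((lat α β p).2 * t.1)
    rw [conj_phase] at c1 c2
    rw [e1, e2]
    set P := phase ((lat α β p).1 * (lat α β p).2)
    set P' := phase (-((lat α β p).1 * (lat α β p).2))
    set R := phase ((lat α β p).2 * t.1)
    set R' := phase (-((lat α β p).2 * t.1))
    linear_combination ⟪tf (lat α β p) γ, tf t g⟫_ℂ * ⟪tf μ (tf t γ), tf (lat α β p) g⟫_ℂ *
      (R' * R * c1 + c2)
  have heq : ⟪tf μ γ, g⟫_ℂ = ⟪tf μ (tf t γ), tf t g⟫_ℂ := (h3.of_forall_eq hterm).unique h1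
  rw [tf_comm μ t, inner_smul_left, inner_tf_tf, conj_phase] at heq
  by_contra hne
  obtain ⟨n, hn⟩ := exists_int_of_phase_eq_one (mul_right_cancel₀ hne (heq.symm.trans (one_mul _).symm))
  refine hq ⟨-n, ?_⟩
  have h6 : ((q.2 : ℤ) : ℝ) = ν * -n := by
    rw [← hn, hμ, ht]
    simp only [lat]
    field_simp
    ring
  exact_mod_cast h6

/-- The dual window reproduces, up to the factor `αβ`, the window along the adjoint lattice. -/
lemma hasSum_adjoint_reconstruction {g γ : L2} {α β : ℝ} (hα : 0 < α) (hβ : 0 < β)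
    (hg : GaborBessel α β g) (hγ : GaborBessel α β γ)
    (hrec : HasSum (fun p => ⟪tf (lat α β p) γ, g⟫_ℂ • tf (lat α β p) g) g) (q₀ : ℤ × ℤ) :
    HasSum (fun q => ((((α * β)⁻¹ : ℝ) : ℂ) *
      ⟪tf (lat β⁻¹ α⁻¹ q) γ, tf (lat β⁻¹ α⁻¹ q₀) g⟫_ℂ) • tf (lat β⁻¹ α⁻¹ q) g)
      (tf (lat β⁻¹ α⁻¹ q₀) g) := by
  have hg' := hg.adjoint_lattice hα hβ
  obtain ⟨S, hS⟩ := hg'.choose_spec.summable_smul (hg'.summable_function γ)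
  have hSg : (((α * β)⁻¹ : ℝ) : ℂ) • S = g := by
    refine ext_inner_left ℂ fun h => ?_
    rw [inner_smul_right, ← hasSum_gaborForm hS, ← hasSum_gaborForm hrec]
    exact (figa_of_gaborBessel hα hβ hg hγ hg h).symm
  have h1 := (hasSum_inner_tf_smul_tf hS q₀).const_smul (((α * β)⁻¹ : ℝ) : ℂ)
  rw [← tf_smul, hSg] at h1
  exact h1.of_forall_eq fun q => by rw [smul_smul]

/-- Functions orthogonal to the adjoint Gabor system of the window are orthogonal to that of the
dual window. -/
lemma inner_adjoint_dual_eq_zero {g γ f : L2} {α β : ℝ} (hα : 0 < α) (hβ : 0 < β)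
    (hg : GaborBessel α β g) (hγ : GaborBessel α β γ)
    (hrec : HasSum (fun p => ⟪tf (lat α β p) γ, g⟫_ℂ • tf (lat α β p) γ) γ)
    (hf : ∀ q, ⟪tf (lat β⁻¹ α⁻¹ q) g, f⟫_ℂ = 0) (q : ℤ × ℤ) :
    ⟪tf (lat β⁻¹ α⁻¹ q) γ, f⟫_ℂ = 0 := by
  set h := tf (-lat β⁻¹ α⁻¹ q) f with hh
  have h1 : ∀ p, ⟪h, tf (lat β⁻¹ α⁻¹ p) g⟫_ℂ = 0 := fun p => by
    rw [hh, inner_tf_left, neg_neg, tf_tf, ← lat_add, inner_smul_right, ← inner_conj_symm,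
      hf, map_zero, mul_zero, mul_zero]
  have h2 := figa_of_gaborBessel hα hβ hg hγ hγ h
  rw [Figa, hasSum_gaborForm hrec, gaborForm] at h2
  simp only [h1, mul_zero, tsum_zero] at h2
  rw [inner_tf_left, ← inner_conj_symm, h2, map_zero, mul_zero]

lemma norm_inner_tf_lat_tf_lat (a b : ℝ) (p q : ℤ × ℤ) (u f : L2) :
    ‖⟪tf (lat a b p) u, tf (lat a b q) f⟫_ℂ‖ = ‖⟪tf (lat a b (p - q)) u, f⟫_ℂ‖ := by
  rw [inner_tf_right, ← lat_neg, tf_tf, ← lat_add, inner_smul_left, norm_mul, norm_mul,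
    RCLike.norm_conj, norm_phase, norm_phase, one_mul, one_mul, neg_add_eq_sub]

lemma clm_eq_of_mem_closure_span {s : Set L2} {P Q : L2 →L[ℂ] L2} (h : ∀ x ∈ s, P x = Q x)
    {f : L2} (hf : f ∈ (Submodule.span ℂ s).topologicalClosure) : P f = Q f := by
  have h1 : Submodule.span ℂ s ≤ LinearMap.eqLocus (P : L2 →ₗ[ℂ] L2) (Q : L2 →ₗ[ℂ] L2) :=
    Submodule.span_le.mpr h
  exact Submodule.topologicalClosure_minimal _ h1 (isClosed_eq P.continuous Q.continuous) hf

lemma tf_Mo_smul_eq (b : ℝ) (z : ℝ × ℝ) (c : ℂ) (u v f : L2) :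
    (c * ⟪tf z u, Mo (-b) f⟫_ℂ) • Mo b (tf z v)
      = (c * ⟪tf (z.1, z.2 + b) u, f⟫_ℂ) • tf (z.1, z.2 + b) v := by
  have h1 : ∀ w, Mo b (tf z w) = phase (b * z.1) • tf (z.1, z.2 + b) w := fun w => by
    rw [Mo_eq_tf, tf_tf]
    congr 2
    ext <;> simp [add_comm]
  have h2 : ⟪tf z u, Mo (-b) f⟫_ℂ = ⟪Mo b (tf z u), f⟫_ℂ := by
    rw [Mo_eq_tf, Mo_eq_tf, inner_tf_left (0, b)]
    simp [phase_zero]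
  rw [h2, h1, h1, mul_smul, inner_phase_smul_smul, smul_smul]

/-- A Bessel family with a Bessel dual satisfies frame bounds on the vectors it reconstructs. -/
lemma frame_bounds_of_dual {ι H : Type*} [NormedAddCommGroup H] [InnerProductSpace ℂ H]
    {e d : ι → H} {C D c : ℝ} (hc : 0 < c) (he : IsBessel e C) (hd : IsBessel d D) :
    ∃ A B : ℝ, 0 < A ∧ 0 < B ∧ ∀ f : H,
      HasSum (fun i => ((c : ℂ) * ⟪d i, f⟫_ℂ) • e i) f →
      A * ‖f‖ ^ 2 ≤ ∑' i, ‖⟪e i, f⟫_ℂ‖ ^ 2 ∧ ∑' i, ‖⟪e i, f⟫_ℂ‖ ^ 2 ≤ B * ‖f‖ ^ 2 := by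
  have hC := he.nonneg
  have hD := hd.nonneg
  refine ⟨(c ^ 2 * (D + 1))⁻¹, C + 1, by positivity, by positivity, fun f hf => ⟨?_, ?_⟩⟩
  · set σ := ∑' i, ‖⟪e i, f⟫_ℂ‖ ^ 2 with hσ
    have hσ0 : 0 ≤ σ := tsum_nonneg fun _ => by positivity
    have h2 : ‖⟪f, f⟫_ℂ‖ ^ 2 ≤ c ^ 2 * (D * ‖f‖ ^ 2) * σ := by
      have hlim := (((innerSL ℂ f).hasSum hf).norm.pow 2)
      refine le_of_tendsto hlim (Eventually.of_forall fun F => ?_)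
      have h3 : ‖∑ i ∈ F, innerSL ℂ f (((c : ℂ) * ⟪d i, f⟫_ℂ) • e i)‖
          ≤ ∑ i ∈ F, c * ‖⟪d i, f⟫_ℂ‖ * ‖⟪e i, f⟫_ℂ‖ := by
        refine (norm_sum_le _ _).trans (le_of_eq (Finset.sum_congr rfl fun i _ => ?_))
        rw [innerSL_apply_apply, inner_smul_right, norm_mul, norm_mul, Complex.norm_real,
          Real.norm_of_nonneg hc.le, norm_inner_symm f]
      calc _ ≤ (∑ i ∈ F, c * ‖⟪d i, f⟫_ℂ‖ * ‖⟪e i, f⟫_ℂ‖) ^ 2 :=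
            pow_le_pow_left₀ (norm_nonneg _) h3 2
        _ ≤ (∑ i ∈ F, (c * ‖⟪d i, f⟫_ℂ‖) ^ 2) * ∑ i ∈ F, ‖⟪e i, f⟫_ℂ‖ ^ 2 :=
            Finset.sum_mul_sq_le_sq_mul_sq _ _ _
        _ = (c ^ 2 * ∑ i ∈ F, ‖⟪d i, f⟫_ℂ‖ ^ 2) * ∑ i ∈ F, ‖⟪e i, f⟫_ℂ‖ ^ 2 := by
            simp only [mul_pow, Finset.mul_sum]
        _ ≤ c ^ 2 * (D * ‖f‖ ^ 2) * σ := by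
            gcongr
            · exact hd.sum_le f F
            · exact (he.summable f).sum_le_tsum F fun _ _ => by positivity
    rw [inner_self_eq_norm_sq_to_K, norm_pow, RCLike.norm_ofReal, abs_norm] at h2
    rw [inv_mul_le_iff₀ (by positivity)]
    rcases eq_or_lt_of_le (norm_nonneg f) with h0 | h0
    · rw [← h0, zero_pow two_ne_zero]
      positivity
    · have h3 : 0 < ‖f‖ ^ 2 := by positivity
      refine le_of_mul_le_mul_right ?_ h3
      nlinarith [mul_nonneg (mul_nonneg (sq_nonneg c) hσ0) (sq_nonneg ‖f‖)]
  · refine (he.tsum_le f).trans ?_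
    nlinarith [sq_nonneg ‖f‖]

/-- under `T_{α/ν} g ∈ 𝒢`, each `𝔉_s` is a frame for `ℒ_s` and
`P_s = (αβ)⁻¹ M_{s/α} S_{γ,g} M_{-s/α}` acts as the identity on `ℒ_s`, as zero
on each `ℒ_r` (`r ≠ s`) and as zero on `𝒦^⊥`. -/
theorem statement_16 (g : L2) (hg : InS0 g) (α β : ℝ) (hα : 0 < α) (hβ : 0 < β)
    (hframe : IsFrameSeq g (sepLattice α β)) (γ : L2) (hγ : IsDualWindow g γ α β)
    (ν : ℕ) (hν : 1 ≤ ν)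
    (hshift : Tr (α / ν) g ∈ gaborSpan g (sepLattice α β)) :
    ∀ s : ℕ, s < ν →
      (∃ A B : ℝ, 0 < A ∧ 0 < B ∧ ∀ f ∈ Lsub g α β ν s,
        A * ‖f‖ ^ 2 ≤ (∑' kl : ℤ × ℤ,
          ‖⟪tf ((kl.1 : ℝ) / β, ((kl.2 : ℝ) * (ν : ℝ) + (s : ℝ)) / α) g, f⟫_ℂ‖ ^ 2) ∧
        (∑' kl : ℤ × ℤ,
          ‖⟪tf ((kl.1 : ℝ) / β, ((kl.2 : ℝ) * (ν : ℝ) + (s : ℝ)) / α) g, f⟫_ℂ‖ ^ 2)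
            ≤ B * ‖f‖ ^ 2) ∧
      (∀ f ∈ Lsub g α β ν s,
        HasSum (fun kl : ℤ × ℤ =>
          ((((α * β)⁻¹ : ℝ) : ℂ) *
              ⟪tf ((kl.1 : ℝ) / β, (kl.2 : ℝ) * (ν : ℝ) / α) γ, Mo (-(s : ℝ) / α) f⟫_ℂ)
            • Mo ((s : ℝ) / α) (tf ((kl.1 : ℝ) / β, (kl.2 : ℝ) * (ν : ℝ) / α) g)) f) ∧
      (∀ r : ℕ, r < ν → r ≠ s → ∀ f ∈ Lsub g α β ν r,
        HasSum (fun kl : ℤ × ℤ =>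
          ((((α * β)⁻¹ : ℝ) : ℂ) *
              ⟪tf ((kl.1 : ℝ) / β, (kl.2 : ℝ) * (ν : ℝ) / α) γ, Mo (-(s : ℝ) / α) f⟫_ℂ)
            • Mo ((s : ℝ) / α) (tf ((kl.1 : ℝ) / β, (kl.2 : ℝ) * (ν : ℝ) / α) g)) 0) ∧
      (∀ f : L2, (∀ h ∈ Ksub g α β, ⟪h, f⟫_ℂ = 0) →
        HasSum (fun kl : ℤ × ℤ =>
          ((((α * β)⁻¹ : ℝ) : ℂ) *
              ⟪tf ((kl.1 : ℝ) / β, (kl.2 : ℝ) * (ν : ℝ) / α) γ, Mo (-(s : ℝ) / α) f⟫_ℂ)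
            • Mo ((s : ℝ) / α) (tf ((kl.1 : ℝ) / β, (kl.2 : ℝ) * (ν : ℝ) / α) g)) 0) := by
  intro s hs
  set c : ℝ := (α * β)⁻¹ with hc
  have hc0 : 0 < c := by positivity
  obtain ⟨hgB, hγB, hsymm, hrec⟩ := hframe.canonical_dual hα.ne' hβ.ne' hγ
  have hγG : γ ∈ gaborSub α β g := by
    have := hγ.1
    rwa [← coe_gaborSub] at this
  have hgG : g ∈ gaborSub α β g := by
    simpa [lat, ← Prod.zero_eq_mk, tf_zero] using tf_mem_gaborSub α β g 0
  rw [← coe_gaborSub, Tr_eq_tf] at hshift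
  have hvanish : ∀ q : ℤ × ℤ, ¬ (ν : ℤ) ∣ q.2 → ⟪tf (lat β⁻¹ α⁻¹ q) γ, g⟫_ℂ = 0 := fun q =>
    inner_tf_dual_window_eq_zero hα hβ hγG hrec hν hshift
  have hrepro := hasSum_adjoint_reconstruction hα hβ hgB hγB (hrec g hgG).2
  have hvanish' : ∀ q q₀ : ℤ × ℤ, ¬ (ν : ℤ) ∣ q.2 - q₀.2 →
      ⟪tf (lat β⁻¹ α⁻¹ q) γ, tf (lat β⁻¹ α⁻¹ q₀) g⟫_ℂ = 0 := fun q q₀ h => by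
    rw [← norm_eq_zero, norm_inner_tf_lat_tf_lat, hvanish (q - q₀) h, norm_zero]
  set φ : ℕ → ℤ × ℤ → ℤ × ℤ := fun r p => (p.1, p.2 * ν + r) with hφ
  have hpt : ∀ (r : ℕ) (k l : ℤ), ((k : ℝ) / β, ((l : ℝ) * (ν : ℝ) + (r : ℝ)) / α)
      = lat β⁻¹ α⁻¹ (φ r (k, l)) := fun r k l => by
    simp only [lat, hφ]
    push_cast
    ext <;> simp only <;> ring
  have hinj : Function.Injective (φ s) := fun p q h => by
    have hν0 : (ν : ℤ) ≠ 0 := by positivity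
    simp only [hφ, Prod.mk.injEq, add_left_inj, mul_left_inj' hν0] at h
    exact Prod.ext h.1 h.2
  have hterm : ∀ (f : L2) (kl : ℤ × ℤ), ((c : ℂ) *
      ⟪tf ((kl.1 : ℝ) / β, (kl.2 : ℝ) * (ν : ℝ) / α) γ, Mo (-(s : ℝ) / α) f⟫_ℂ)
        • Mo ((s : ℝ) / α) (tf ((kl.1 : ℝ) / β, (kl.2 : ℝ) * (ν : ℝ) / α) g)
      = ((c : ℂ) * ⟪tf (lat β⁻¹ α⁻¹ (φ s kl)) γ, f⟫_ℂ) • tf (lat β⁻¹ α⁻¹ (φ s kl)) g :=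
    fun f kl => by rw [neg_div, tf_Mo_smul_eq, ← add_div, hpt]
  simp only [hterm, hpt]
  obtain ⟨C, hC⟩ := hgB.adjoint_lattice hα hβ
  obtain ⟨D, hD⟩ := hγB.adjoint_lattice hα hβ
  have hC' := hC.comp_injective hinj
  have hD' := hD.comp_injective hinj
  obtain ⟨P, hP⟩ := hD'.exists_mixed_frame_operator hC'
  have hP' : ∀ f, HasSum (fun kl => ((c : ℂ) * ⟪tf (lat β⁻¹ α⁻¹ (φ s kl)) γ, f⟫_ℂ) •
      tf (lat β⁻¹ α⁻¹ (φ s kl)) g) (((c : ℂ) • P) f) := fun f =>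
    ((hP f).const_smul (c : ℂ)).of_forall_eq fun kl => by rw [smul_smul]
  have hid : ∀ f ∈ Lsub g α β ν s, ((c : ℂ) • P) f = f := fun f hf => by
    refine clm_eq_of_mem_closure_span (Q := ContinuousLinearMap.id ℂ L2) ?_ hf
    rintro _ ⟨k, l, rfl⟩
    rw [hpt]
    refine (hP' _).unique ?_
    refine (hinj.hasSum_iff fun q hq => ?_).mpr (hrepro (φ s (k, l)))
    rw [hvanish', mul_zero, zero_smul]
    rintro ⟨m, hm⟩
    refine hq ⟨(q.1, m + l), Prod.ext rfl ?_⟩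
    simp only [hφ] at hm ⊢
    linear_combination -hm
  have hzero : ∀ r : ℕ, r < ν → r ≠ s → ∀ f ∈ Lsub g α β ν r, ((c : ℂ) • P) f = 0 :=
    fun r hr hrs f hf => by
      refine clm_eq_of_mem_closure_span (Q := 0) ?_ hf
      rintro _ ⟨k, l, rfl⟩
      rw [hpt]
      refine (hP' _).unique (hasSum_zero.of_forall_eq fun p => ?_)
      rw [hvanish', mul_zero, zero_smul]
      rintro ⟨m, hm⟩
      simp only [hφ] at hm
      have h1 : ((s : ℤ) - r) = ν * (m - p.2 + l) := by linear_combination hm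
      have h2 : |(s : ℤ) - r| < ν := by rw [abs_lt]; omega
      have h3 := Int.eq_zero_of_abs_lt_dvd ⟨_, h1⟩ h2
      omega
  refine ⟨?_, fun f hf => ?_, fun r hr hrs f hf => ?_, fun f hf => ?_⟩
  · obtain ⟨A, B, hA, hB, hAB⟩ := frame_bounds_of_dual hc0 hC' hD'
    refine ⟨A, B, hA, hB, fun f hf => hAB f ?_⟩
    have := hP' f
    rwa [hid f hf] at this
  · have := hP' f
    rwa [hid f hf] at this
  · have := hP' f
    rwa [hzero r hr hrs f hf] at this
  · refine hasSum_zero.of_forall_eq fun p => ?_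
    have hγγ : HasSum (fun p => ⟪tf (lat α β p) γ, g⟫_ℂ • tf (lat α β p) γ) γ :=
      (hrec γ hγG).1.of_forall_eq fun p => by rw [hsymm]
    rw [inner_adjoint_dual_eq_zero hα hβ hgB hγB hγγ (fun q => ?_), mul_zero, zero_smul]
    refine hf _ (Submodule.le_topologicalClosure _ (Submodule.subset_span ⟨q.1, q.2, ?_⟩))
    congr 1
    ext <;> simp only [lat] <;> ring

end
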